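/- Let (A, Q) be a relative n-Auslander–Gorenstein pair with Ext^{i>0}_A(Q, Q) = 0 and n ≥ m + l + 2 where m = id_A Q and l = pd_A Q, and Λ = End_A(Q)^op. Then the following are equivalent: (i) A has finite global dimension (i.e., (A, Q) is a relative n-Auslander pair); (ii) add(Q_Λ) = {X ∈ mod-Λ : Ext^i_Λ(X, Q) = 0 for 1 ≤ i ≤ m and Ext^j_Λ(Q, X) = 0 for 1 ≤ j ≤ n − m − 2}; (iii) add(Q_Λ) = {X ∈ mod-Λ : Ext^i_Λ(X, Q) = 0 for 1 ≤ i ≤ n − l − 2 and Ext^j_Λ(Q, X) = 0 for 1 ≤ j ≤ l}. -/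

import Mathlib

universe u
open MulOpposite

noncomputable section
namespace Paper

section RingDefs
variable (B : Type u) [Ring B]

/-- `X` belongs to `add Q`: it is a direct summand of a finite direct sum of copies of `Q`. -/
def InAdd (Q X : ModuleCat.{u} B) : Prop :=
  ∃ (n : ℕ) (s : X →ₗ[B] (Fin n → Q)) (r : (Fin n → Q) →ₗ[B] X), r ∘ₗ s = LinearMap.id

/-- A superfluous (small) submodule. -/
def Superfluous {P : ModuleCat.{u} B} (N : Submodule B P) : Prop :=
  ∀ K : Submodule B P, K ⊔ N = ⊤ → K = ⊤

/-- An essential (large) submodule. -/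
def Essential {P : ModuleCat.{u} B} (N : Submodule B P) : Prop :=
  ∀ K : Submodule B P, K ⊓ N = ⊥ → K = ⊥

/-- `p : P → X` is a projective cover. -/
def IsProjCover {P X : ModuleCat.{u} B} (p : P →ₗ[B] X) : Prop :=
  Module.Projective B P ∧ Function.Surjective p ∧ Superfluous B (LinearMap.ker p)

/-- `ι : X → I` is an injective envelope. -/
def IsInjEnvelope {X I : ModuleCat.{u} B} (ι : X →ₗ[B] I) : Prop :=
  Module.Injective B I ∧ Function.Injective ι ∧ Essential B (LinearMap.range ι)

/-- The zero module. -/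
def zeroMod : ModuleCat.{u} B := ModuleCat.of B PUnit

/-- An exact sequence `0 → P_m → ⋯ → P_1 → P_0 → X → 0` whose terms satisfy the
predicate `T` and which remains exact under `Hom(test, −)`. -/
def ResLE (test : ModuleCat.{u} B) (T : ModuleCat.{u} B → Prop)
    (X : ModuleCat.{u} B) (m : ℕ) : Prop :=
  ∃ (P : ℕ → ModuleCat.{u} B) (d : ∀ j, P (j+1) →ₗ[B] P j) (aug : P 0 →ₗ[B] X),
    (∀ j, j ≤ m → T (P j)) ∧ (∀ j, m < j → Subsingleton (P j)) ∧
    Function.Surjective aug ∧ Function.Exact (d 0) aug ∧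
    (∀ j, Function.Exact (d (j+1)) (d j)) ∧
    (∀ f : test →ₗ[B] X, ∃ h : test →ₗ[B] P 0, aug ∘ₗ h = f) ∧
    (∀ f : test →ₗ[B] P 0, aug ∘ₗ f = 0 → ∃ h : test →ₗ[B] P 1, d 0 ∘ₗ h = f) ∧
    (∀ j, ∀ f : test →ₗ[B] P (j+1), d j ∘ₗ f = 0 →
      ∃ h : test →ₗ[B] P (j+2), d (j+1) ∘ₗ h = f)

/-- An exact sequence `0 → X → I_0 → ⋯ → I_m → 0` whose terms satisfy the predicate `T`
and which remains exact under `Hom(−, test)`. -/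
def CoresLE (test : ModuleCat.{u} B) (T : ModuleCat.{u} B → Prop)
    (X : ModuleCat.{u} B) (m : ℕ) : Prop :=
  ∃ (M : ℕ → ModuleCat.{u} B) (ι : X →ₗ[B] M 0) (d : ∀ j, M j →ₗ[B] M (j+1)),
    (∀ j, j ≤ m → T (M j)) ∧ (∀ j, m < j → Subsingleton (M j)) ∧
    Function.Injective ι ∧ Function.Exact ι (d 0) ∧
    (∀ j, Function.Exact (d j) (d (j+1))) ∧
    (∀ f : X →ₗ[B] test, ∃ h : M 0 →ₗ[B] test, h ∘ₗ ι = f) ∧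
    (∀ f : M 0 →ₗ[B] test, f ∘ₗ ι = 0 → ∃ h : M 1 →ₗ[B] test, h ∘ₗ d 0 = f) ∧
    (∀ j, ∀ f : M (j+1) →ₗ[B] test, f ∘ₗ d j = 0 →
      ∃ h : M (j+2) →ₗ[B] test, h ∘ₗ d (j+1) = f)

/-- Projective dimension at most `n`. -/
def pdLE (X : ModuleCat.{u} B) (n : ℕ) : Prop :=
  ResLE B (zeroMod B) (fun P => Module.Projective B P) X n

/-- Injective dimension at most `n`. -/
def idLE (X : ModuleCat.{u} B) (n : ℕ) : Prop :=
  CoresLE B (zeroMod B) (fun I => Module.Injective B I) X n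

/-- Projective dimension equal to `n`. -/
def pdEq (X : ModuleCat.{u} B) (n : ℕ) : Prop :=
  pdLE B X n ∧ ∀ j, pdLE B X j → n ≤ j

/-- Injective dimension equal to `n`. -/
def idEq (X : ModuleCat.{u} B) (n : ℕ) : Prop :=
  idLE B X n ∧ ∀ j, idLE B X j → n ≤ j

/-- Projective dimension as an element of `ℕ∞`. -/
def pdDim (X : ModuleCat.{u} B) : ℕ∞ :=
  sInf {c : ℕ∞ | ∃ n : ℕ, c = n ∧ pdLE B X n}

/-- Injective dimension as an element of `ℕ∞`. -/
def idDim (X : ModuleCat.{u} B) : ℕ∞ :=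
  sInf {c : ℕ∞ | ∃ n : ℕ, c = n ∧ idLE B X n}

/-- Relative dominant dimension of `X` with respect to `Q` is at least `n`:
there is an exact sequence `0 → X → Q_1 → ⋯ → Q_n` with `Q_i ∈ add Q`
remaining exact under `Hom(−, Q)`. -/
def domdimGE (Q X : ModuleCat.{u} B) (n : ℕ) : Prop :=
  n = 0 ∨ ∃ (M : ℕ → ModuleCat.{u} B) (ι : X →ₗ[B] M 0) (d : ∀ j, M j →ₗ[B] M (j+1)),
    (∀ j, j + 1 ≤ n → InAdd B Q (M j)) ∧
    Function.Injective ι ∧ (2 ≤ n → Function.Exact ι (d 0)) ∧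
    (∀ j, j + 3 ≤ n → Function.Exact (d j) (d (j+1))) ∧
    (∀ f : X →ₗ[B] Q, ∃ h : M 0 →ₗ[B] Q, h ∘ₗ ι = f) ∧
    (2 ≤ n → ∀ f : M 0 →ₗ[B] Q, f ∘ₗ ι = 0 → ∃ h : M 1 →ₗ[B] Q, h ∘ₗ d 0 = f) ∧
    (∀ j, j + 3 ≤ n → ∀ f : M (j+1) →ₗ[B] Q, f ∘ₗ d j = 0 →
      ∃ h : M (j+2) →ₗ[B] Q, h ∘ₗ d (j+1) = f)

/-- Relative codominant dimension of `X` with respect to `Q` is at least `n`. -/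
def codomdimGE (Q X : ModuleCat.{u} B) (n : ℕ) : Prop :=
  n = 0 ∨ ∃ (M : ℕ → ModuleCat.{u} B) (aug : M 0 →ₗ[B] X) (d : ∀ j, M (j+1) →ₗ[B] M j),
    (∀ j, j + 1 ≤ n → InAdd B Q (M j)) ∧
    Function.Surjective aug ∧ (2 ≤ n → Function.Exact (d 0) aug) ∧
    (∀ j, j + 3 ≤ n → Function.Exact (d (j+1)) (d j)) ∧
    (∀ f : Q →ₗ[B] X, ∃ h : Q →ₗ[B] M 0, aug ∘ₗ h = f) ∧
    (2 ≤ n → ∀ f : Q →ₗ[B] M 0, aug ∘ₗ f = 0 → ∃ h : Q →ₗ[B] M 1, d 0 ∘ₗ h = f) ∧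
    (∀ j, j + 3 ≤ n → ∀ f : Q →ₗ[B] M (j+1), d j ∘ₗ f = 0 →
      ∃ h : Q →ₗ[B] M (j+2), d (j+1) ∘ₗ h = f)

/-- Relative dominant dimension with respect to `Q`, as an element of `ℕ∞`. -/
def relDomDim (Q X : ModuleCat.{u} B) : ℕ∞ :=
  sSup {c : ℕ∞ | ∃ n : ℕ, c = n ∧ domdimGE B Q X n}

/-- Relative codominant dimension with respect to `Q`, as an element of `ℕ∞`. -/
def relCodomDim (Q X : ModuleCat.{u} B) : ℕ∞ :=
  sSup {c : ℕ∞ | ∃ n : ℕ, c = n ∧ codomdimGE B Q X n}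

/-- A projective resolution. -/
structure ProjRes (X : ModuleCat.{u} B) where
  P : ℕ → ModuleCat.{u} B
  d : ∀ j, P (j+1) →ₗ[B] P j
  aug : P 0 →ₗ[B] X
  proj : ∀ j, Module.Projective B (P j)
  augSurj : Function.Surjective aug
  exact0 : Function.Exact (d 0) aug
  exact : ∀ j, Function.Exact (d (j+1)) (d j)

/-- Vanishing of `Ext^i(X, Y)`, expressed via projective resolutions. -/
def ExtVanish (X Y : ModuleCat.{u} B) : ℕ → Prop
  | 0 => Subsingleton (X →ₗ[B] Y)
  | (i+1) => ∀ R : ProjRes B X, ∀ f : R.P (i+1) →ₗ[B] Y,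
      f ∘ₗ R.d (i+1) = 0 → ∃ g : R.P i →ₗ[B] Y, f = g ∘ₗ R.d i

/-- `Q` is self-orthogonal: `Ext^i(Q, Q) = 0` for all `i > 0`. -/
def SelfOrth (Q : ModuleCat.{u} B) : Prop := ∀ i, 1 ≤ i → ExtVanish B Q Q i

/-- `Z` is a (first, minimal) syzygy of `X`. -/
def IsSyzygyOf (X Z : ModuleCat.{u} B) : Prop :=
  ∃ (P : ModuleCat.{u} B) (p : P →ₗ[B] X), IsProjCover B p ∧
    Nonempty (Z ≃ₗ[B] LinearMap.ker p)

/-- `Z` is an `n`-th syzygy `Ω^n X`. -/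
def IsOmegaOf : ℕ → ModuleCat.{u} B → ModuleCat.{u} B → Prop
  | 0, X, Z => Nonempty (Z ≃ₗ[B] X)
  | (n+1), X, Z => ∃ Y, IsSyzygyOf B X Y ∧ IsOmegaOf n Y Z

/-- `Z` is a (first, minimal) cosyzygy of `X`. -/
def IsCosyzygyOf (X Z : ModuleCat.{u} B) : Prop :=
  ∃ (I : ModuleCat.{u} B) (ι : X →ₗ[B] I), IsInjEnvelope B ι ∧
    Nonempty (Z ≃ₗ[B] (I ⧸ LinearMap.range ι))

/-- `Z` is an `n`-th cosyzygy `Ω^{-n} X`. -/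
def IsOmegaInvOf : ℕ → ModuleCat.{u} B → ModuleCat.{u} B → Prop
  | 0, X, Z => Nonempty (Z ≃ₗ[B] X)
  | (n+1), X, Z => ∃ Y, IsCosyzygyOf B X Y ∧ IsOmegaInvOf n Y Z

/-- Precomposition with `g`, as a map of right `B`-modules `Hom(P₀,B) → Hom(P₁,B)`. -/
def lprecomp {P1 P0 : ModuleCat.{u} B} (g : P1 →ₗ[B] P0) :
    (P0 →ₗ[B] B) →ₗ[Bᵐᵒᵖ] (P1 →ₗ[B] B) where
  toFun h := h ∘ₗ g
  map_add' _ _ := rfl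
  map_smul' _ _ := rfl

/-- `T` is a transpose `Tr X` (computed from a minimal projective presentation). -/
def IsTransposeOf (X : ModuleCat.{u} B) (T : ModuleCat.{u} Bᵐᵒᵖ) : Prop :=
  ∃ (P1 P0 : ModuleCat.{u} B) (g : P1 →ₗ[B] P0) (p : P0 →ₗ[B] X),
    IsProjCover B p ∧ Module.Projective B P1 ∧ Function.Exact g p ∧
    Superfluous B (LinearMap.ker g) ∧
    Nonempty (T ≃ₗ[Bᵐᵒᵖ] ((P1 →ₗ[B] B) ⧸ LinearMap.range (lprecomp B g)))

/-- The canonical ring homomorphism `B →+* Bᵐᵒᵖᵐᵒᵖ`. -/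
def opOpHom : B →+* Bᵐᵒᵖᵐᵒᵖ where
  toFun b := op (op b)
  map_one' := rfl
  map_mul' _ _ := rfl
  map_zero' := rfl
  map_add' _ _ := rfl


/-- An `F_Mo`-projective resolution: terms in `add(B ⊕ Mo)`, exact, and remaining
exact under `Hom(Mo, −)`. -/
structure FProjRes (Mo X : ModuleCat.{u} B) where
  P : ℕ → ModuleCat.{u} B
  d : ∀ j, P (j+1) →ₗ[B] P j
  aug : P 0 →ₗ[B] X
  mem : ∀ j, InAdd B (ModuleCat.of B (B × Mo)) (P j)
  augSurj : Function.Surjective aug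
  exact0 : Function.Exact (d 0) aug
  exact : ∀ j, Function.Exact (d (j+1)) (d j)
  lift0 : ∀ f : Mo →ₗ[B] X, ∃ h : Mo →ₗ[B] P 0, aug ∘ₗ h = f
  lift1 : ∀ f : Mo →ₗ[B] P 0, aug ∘ₗ f = 0 → ∃ h : Mo →ₗ[B] P 1, d 0 ∘ₗ h = f
  lift : ∀ j, ∀ f : Mo →ₗ[B] P (j+1), d j ∘ₗ f = 0 →
    ∃ h : Mo →ₗ[B] P (j+2), d (j+1) ∘ₗ h = f

/-- Vanishing of the relative extension group `Ext^i_{F_Mo}(X, Y)`, computed via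
`F_Mo`-projective resolutions. -/
def FExtVanish (Mo X Y : ModuleCat.{u} B) : ℕ → Prop
  | 0 => True
  | (i+1) => ∀ R : FProjRes B Mo X, ∀ f : R.P (i+1) →ₗ[B] Y,
      f ∘ₗ R.d (i+1) = 0 → ∃ g : R.P i →ₗ[B] Y, f = g ∘ₗ R.d i

end RingDefs

section Duality
variable (k : Type u) [Field k] (B : Type u) [Ring B] [Algebra k B]

noncomputable instance kmod (X : ModuleCat.{u} B) : Module k X :=
  Module.compHom X (algebraMap k B)

instance kmodSMulComm (X : ModuleCat.{u} B) : SMulCommClass B k X :=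
  ⟨fun b c x => by
    show b • ((algebraMap k B c) • x) = (algebraMap k B c) • (b • x)
    rw [← mul_smul, ← mul_smul, Algebra.commutes]⟩

instance kmodTower (X : ModuleCat.{u} B) : IsScalarTower k B X :=
  ⟨fun c b x => by
    show (c • b) • x = (algebraMap k B c) • (b • x)
    rw [Algebra.smul_def, mul_smul]⟩

noncomputable instance dualModL (X : ModuleCat.{u} B) : Module Bᵐᵒᵖ (X →ₗ[k] k) where
  smul b φ := φ ∘ₗ (DistribMulAction.toLinearMap k X b.unop)
  one_smul φ := by
    ext x
    show φ ((1 : Bᵐᵒᵖ).unop • x) = φ x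
    rw [unop_one, one_smul]
  mul_smul b c φ := by
    ext x
    show φ ((b * c).unop • x) = φ (c.unop • b.unop • x)
    rw [unop_mul, mul_smul]
  smul_zero b := rfl
  smul_add b φ ψ := rfl
  add_smul b c φ := by
    ext x
    show φ ((b + c).unop • x) = φ (b.unop • x) + φ (c.unop • x)
    rw [unop_add, add_smul, map_add]
  zero_smul φ := by
    ext x
    show φ ((0 : Bᵐᵒᵖ).unop • x) = 0
    rw [unop_zero, zero_smul, map_zero]

/-- The standard duality `D = Hom_k(−, k)`, sending a left `B`-module to a right
`B`-module. -/
def Dop (X : ModuleCat.{u} B) : ModuleCat.{u} Bᵐᵒᵖ :=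
  ModuleCat.of Bᵐᵒᵖ (X →ₗ[k] k)

noncomputable instance dualModR (Y : ModuleCat.{u} Bᵐᵒᵖ) : Module B (Y →ₗ[k] k) where
  smul b φ := φ ∘ₗ (DistribMulAction.toLinearMap k Y (op b))
  one_smul φ := by
    ext x
    show φ ((op (1:B)) • x) = φ x
    rw [op_one, one_smul]
  mul_smul b c φ := by
    ext x
    show φ ((op (b * c)) • x) = φ ((op c) • (op b) • x)
    rw [op_mul, mul_smul]
  smul_zero b := rfl
  smul_add b φ ψ := rfl
  add_smul b c φ := by
    ext x
    show φ ((op (b + c)) • x) = φ ((op b) • x) + φ ((op c) • x)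
    rw [op_add, add_smul, map_add]
  zero_smul φ := by
    ext x
    show φ ((op (0 : B)) • x) = 0
    rw [op_zero, zero_smul, map_zero]

/-- The standard duality `D = Hom_k(−, k)`, sending a right `B`-module to a left
`B`-module. -/
def Dunop (Y : ModuleCat.{u} Bᵐᵒᵖ) : ModuleCat.{u} B :=
  ModuleCat.of B (Y →ₗ[k] k)

/-- `D(B_B)`, the standard injective cogenerator of `B`-Mod. -/
def Dcogen : ModuleCat.{u} B := Dunop k B (ModuleCat.of Bᵐᵒᵖ B)

/-- `T ≅ τ X = D Tr X`, the Auslander–Reiten translate. -/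
def IsTauOf (X T : ModuleCat.{u} B) : Prop :=
  ∃ Tr : ModuleCat.{u} Bᵐᵒᵖ, IsTransposeOf B X Tr ∧ Nonempty (T ≃ₗ[B] Dunop k B Tr)

/-- `T ≅ τ_n X = τ Ω^{n-1} X`. -/
def IsTauN (n : ℕ) (X T : ModuleCat.{u} B) : Prop :=
  ∃ Z, IsOmegaOf B (n-1) X Z ∧ IsTauOf k B Z T

/-- `T ≅ τ⁻ X = Tr D X`, the inverse Auslander–Reiten translate. -/
def IsTauInvOf (X T : ModuleCat.{u} B) : Prop :=
  ∃ Tr2 : ModuleCat.{u} Bᵐᵒᵖᵐᵒᵖ, IsTransposeOf Bᵐᵒᵖ (Dop k B X) Tr2 ∧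
    Nonempty (T ≃ₗ[B] ((ModuleCat.restrictScalars (opOpHom B)).obj Tr2))

/-- `T ≅ τ⁻_n X = τ⁻ Ω^{-(n-1)} X`. -/
def IsTauInvN (n : ℕ) (X T : ModuleCat.{u} B) : Prop :=
  ∃ Z, IsOmegaInvOf B (n-1) X Z ∧ IsTauInvOf k B Z T

/-- The Nakayama functor `ν = D Hom_B(−, B)` (on objects). -/
def nu (X : ModuleCat.{u} B) : ModuleCat.{u} B :=
  Dunop k B (ModuleCat.of Bᵐᵒᵖ (X →ₗ[B] B))

/-- The inverse Nakayama functor `ν⁻ = Hom_B(D(−), B)` (on objects). -/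
def nuInv (X : ModuleCat.{u} B) : ModuleCat.{u} B :=
  (ModuleCat.restrictScalars (opOpHom B)).obj
    (ModuleCat.of Bᵐᵒᵖᵐᵒᵖ ((Dop k B X) →ₗ[Bᵐᵒᵖ] Bᵐᵒᵖ))

/-- Relative `add Q`-dimension of `X` is at most `m`. -/
def RelAddDimLE (Q X : ModuleCat.{u} B) (m : ℕ) : Prop :=
  ResLE B Q (InAdd B Q) X m

/-- Relative `add Q`-codimension of `X` is at most `m`. -/
def RelAddCodimLE (Q X : ModuleCat.{u} B) (m : ℕ) : Prop :=
  CoresLE B Q (InAdd B Q) X m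

/-- `Q` is an `l`-quasi-generator (without minimality of `l`). -/
def QuasiGenLE (Q : ModuleCat.{u} B) (l : ℕ) : Prop :=
  CoresLE B Q (InAdd B Q) (ModuleCat.of B B) l

/-- `Q` is an `l`-quasi-generator: `l` is minimal. -/
def IsQuasiGen (Q : ModuleCat.{u} B) (l : ℕ) : Prop :=
  QuasiGenLE B Q l ∧ ∀ j, QuasiGenLE B Q j → l ≤ j

/-- `Q` is an `m`-quasi-cogenerator (without minimality of `m`). -/
def QuasiCogenLE (Q : ModuleCat.{u} B) (m : ℕ) : Prop :=
  ResLE B Q (InAdd B Q) (Dcogen k B) m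

/-- `Q` is an `m`-quasi-cogenerator: `m` is minimal. -/
def IsQuasiCogen (Q : ModuleCat.{u} B) (m : ℕ) : Prop :=
  QuasiCogenLE k B Q m ∧ ∀ j, QuasiCogenLE k B Q j → m ≤ j

/-- `(B, Q)` is a relative `n`-Auslander–Gorenstein pair. -/
def IsRelAGPair (Q : ModuleCat.{u} B) (n : ℕ) : Prop :=
  idLE B (ModuleCat.of B B) n ∧ idLE Bᵐᵒᵖ (ModuleCat.of Bᵐᵒᵖ Bᵐᵒᵖ) n ∧
  SelfOrth B Q ∧ domdimGE B Q (ModuleCat.of B B) n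

/-- `Q` is an `(n, m, l)`-quasi-precluster tilting module. -/
def IsQPCT (Q : ModuleCat.{u} B) (n m l : ℕ) : Prop :=
  (∀ i, 1 ≤ i → i ≤ n - 2 → ExtVanish B Q Q i) ∧
  IsQuasiGen B Q l ∧
  IsQuasiCogen k B Q m ∧
  (∃ T, IsTauN k B (n - m - 1) Q T ∧ RelAddDimLE B Q T m) ∧
  (∃ T, IsTauInvN k B (n - l - 1) Q T ∧ RelAddCodimLE B Q T l)

/-- Precomposition with `g`, as a `k`-linear map between Hom spaces. -/
def pcompk {X Y Z : ModuleCat.{u} B} (g : X →ₗ[B] Y) :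
    (Y →ₗ[B] Z) →ₗ[k] (X →ₗ[B] Z) where
  toFun h := h ∘ₗ g
  map_add' _ _ := rfl
  map_smul' _ _ := rfl


/-- `I` is an injective object for the exact structure `F_Mo`: it lies in
`add(DB ⊕ τ Mo)`. -/
def IsFInj (Mo I : ModuleCat.{u} B) : Prop :=
  ∃ T, IsTauOf k B Mo T ∧ InAdd B (ModuleCat.of B ((Dcogen k B) × T)) I

/-- `T` is an `F_Mo`-cotilting object: finite relative injective dimension, no relative
self-extensions, and the relative injectives `DB ⊕ τ Mo` admit a finite `F_Mo`-exact
resolution by objects of `add T`. -/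
def FCotilting (Mo T : ModuleCat.{u} B) : Prop :=
  (∃ r, CoresLE B Mo (IsFInj k B Mo) T r) ∧
  (∀ i, 1 ≤ i → FExtVanish B Mo T T i) ∧
  (∃ τM, IsTauOf k B Mo τM ∧
    ∃ r, ResLE B Mo (InAdd B T) (ModuleCat.of B ((Dcogen k B) × τM)) r)

end Duality

section EndStuff
variable (A : Type u) [Ring A] (Q : ModuleCat.{u} A)

/-- The canonical ring homomorphism `A → End_{End_A(Q)}(Q)`. -/
def toEndE : A →+* Module.End (Module.End A Q) Q where
  toFun a :=
    { toFun := fun q => a • q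
      map_add' := fun x y => smul_add a x y
      map_smul' := fun e q => (e.map_smul a q).symm }
  map_one' := by ext q; exact one_smul A q
  map_mul' x y := by ext q; exact mul_smul x y q
  map_zero' := by ext q; exact zero_smul A q
  map_add' x y := by ext q; exact add_smul x y q

/-- `Hom_A(Q, X)` as a left module over `End_A(Q)ᵐᵒᵖ` (i.e. a left `Λ`-module) by
precomposition. -/
noncomputable instance homPrecompMod (X : ModuleCat.{u} A) :
    Module (Module.End A Q)ᵐᵒᵖ (Q →ₗ[A] X) where
  smul e f := f ∘ₗ e.unop
  one_smul f := by ext q; rfl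
  mul_smul e e' f := by ext q; rfl
  smul_zero e := rfl
  smul_add e f g := rfl
  add_smul e e' f := by ext q; exact map_add f _ _
  zero_smul f := by ext q; exact map_zero f

/-- The actions of `A` and of `End_A(Q)` on `Q` commute. -/
instance endSMulComm : SMulCommClass (Module.End A Q) A Q :=
  ⟨fun e a q => e.map_smul a q⟩

instance endSMulComm' : SMulCommClass A (Module.End A Q) Q :=
  ⟨fun a e q => (e.map_smul a q).symm⟩

end EndStuff

end Paper
end

namespace P17
open CategoryTheory CategoryTheory.Abelian Paper

section ExtBasics
variable {R : Type} [Ring R]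

/-- Vanishing of Mathlib's `Ext`. -/
def EV (R : Type) [Ring R] (X Y : Type) [AddCommGroup X] [Module R X] [AddCommGroup Y] [Module R Y]
    (i : ℕ) : Prop :=
  ∀ e : Ext.{0} (ModuleCat.of R X) (ModuleCat.of R Y) i, e = 0

variable {X X1 X2 X3 Y Y1 Y2 Y3 : Type}
  [AddCommGroup X] [Module R X] [AddCommGroup X1] [Module R X1] [AddCommGroup X2] [Module R X2]
  [AddCommGroup X3] [Module R X3] [AddCommGroup Y] [Module R Y] [AddCommGroup Y1] [Module R Y1]
  [AddCommGroup Y2] [Module R Y2] [AddCommGroup Y3] [Module R Y3]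

lemma ses (f : X1 →ₗ[R] X2) (g : X2 →ₗ[R] X3) (hf : Function.Injective f)
    (hg : Function.Surjective g) (h : Function.Exact f g) :
    (ShortComplex.mk (ModuleCat.ofHom f) (ModuleCat.ofHom g)
      (by ext x; exact h.apply_apply_eq_zero x)).ShortExact where
  exact := by
    rw [ShortComplex.ShortExact.moduleCat_exact_iff_function_exact]
    exact h
  mono_f := (ModuleCat.mono_iff_injective _).2 hf
  epi_g := (ModuleCat.epi_iff_surjective _).2 hg

lemma ev_pi_left (n : ℕ) (i : ℕ) (s : X →ₗ[R] (Fin n → X1)) (r : (Fin n → X1) →ₗ[R] X)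
    (h : r ∘ₗ s = LinearMap.id) (hX : EV R X1 Y i) : EV R X Y i := by
  intro e
  have key : (𝟙 (ModuleCat.of R X)) = ∑ k : Fin n,
      ModuleCat.ofHom (LinearMap.proj k ∘ₗ s) ≫
        ModuleCat.ofHom (r ∘ₗ LinearMap.single R (fun _ => X1) k) := by
    ext x
    have := congrArg (fun f => f x) h
    simp only [LinearMap.comp_apply, LinearMap.id_apply] at this
    rw [ModuleCat.hom_sum, LinearMap.sum_apply]
    simp only [ModuleCat.hom_id, LinearMap.id_apply, ModuleCat.hom_comp, ModuleCat.hom_ofHom,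
      LinearMap.comp_apply, LinearMap.proj_apply]
    rw [← map_sum]
    conv_lhs => rw [← this]
    congr 1
    exact (LinearMap.sum_single_apply (fun _ => X1) (s x)).symm
  rw [← e.mk₀_id_comp, key, Ext.mk₀_sum, Ext.sum_comp]
  apply Finset.sum_eq_zero
  intro k _
  rw [← Ext.mk₀_comp_mk₀, Ext.comp_assoc_of_second_deg_zero, hX (Ext.comp _ e _), Ext.comp_zero]

lemma ev_pi_right (n : ℕ) (i : ℕ) (s : Y →ₗ[R] (Fin n → Y1)) (r : (Fin n → Y1) →ₗ[R] Y)
    (h : r ∘ₗ s = LinearMap.id) (hX : EV R X Y1 i) : EV R X Y i := by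
  intro e
  have key : (𝟙 (ModuleCat.of R Y)) = ∑ k : Fin n,
      ModuleCat.ofHom (LinearMap.proj k ∘ₗ s) ≫
        ModuleCat.ofHom (r ∘ₗ LinearMap.single R (fun _ => Y1) k) := by
    ext x
    have := congrArg (fun f => f x) h
    simp only [LinearMap.comp_apply, LinearMap.id_apply] at this
    rw [ModuleCat.hom_sum, LinearMap.sum_apply]
    simp only [ModuleCat.hom_id, LinearMap.id_apply, ModuleCat.hom_comp, ModuleCat.hom_ofHom,
      LinearMap.comp_apply, LinearMap.proj_apply]
    rw [← map_sum]
    conv_lhs => rw [← this]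
    congr 1
    exact (LinearMap.sum_single_apply (fun _ => Y1) (s x)).symm
  rw [← e.comp_mk₀_id, key, Ext.mk₀_sum, Ext.comp_sum]
  apply Finset.sum_eq_zero
  intro k _
  rw [← Ext.mk₀_comp_mk₀, ← Ext.comp_assoc_of_second_deg_zero, hX (Ext.comp e _ _), Ext.zero_comp]

lemma ev_add_left {Q M : ModuleCat.{0} R} (h : InAdd R Q M) {i : ℕ} (hX : EV R Q Y i) :
    EV R M Y i := by
  obtain ⟨n, s, r, h⟩ := h
  exact ev_pi_left n i s r h hX

lemma ev_add_right {Q M : ModuleCat.{0} R} (h : InAdd R Q M) {i : ℕ} (hX : EV R X Q i) :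
    EV R X M i := by
  obtain ⟨n, s, r, h⟩ := h
  exact ev_pi_right n i s r h hX

lemma ev_equiv_left (e : X ≃ₗ[R] X1) {i : ℕ} (h : EV R X1 Y i) : EV R X Y i := by
  refine ev_pi_left 1 i (LinearMap.pi (fun _ => e.toLinearMap))
    (e.symm.toLinearMap ∘ₗ LinearMap.proj 0) ?_ h
  ext x; simp

lemma ev_equiv_right (e : Y ≃ₗ[R] Y1) {i : ℕ} (h : EV R X Y1 i) : EV R X Y i := by
  refine ev_pi_right 1 i (LinearMap.pi (fun _ => e.toLinearMap))
    (e.symm.toLinearMap ∘ₗ LinearMap.proj 0) ?_ h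
  ext x; simp

section

lemma contra1 (f : X1 →ₗ[R] X2) (g : X2 →ₗ[R] X3) (hf : Function.Injective f)
    (hg : Function.Surjective g) (h : Function.Exact f g)
    {i : ℕ} (h2 : EV R X2 Y i) (h3 : EV R X3 Y (i+1)) : EV R X1 Y i := by
  intro e
  obtain ⟨x, hx⟩ := Ext.contravariant_sequence_exact₁ (ses f g hf hg h) _ e (add_comm 1 i) (h3 _)
  rw [← hx, h2 x, Ext.comp_zero]

lemma contra2 (f : X1 →ₗ[R] X2) (g : X2 →ₗ[R] X3) (hf : Function.Injective f)
    (hg : Function.Surjective g) (h : Function.Exact f g)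
    {i : ℕ} (h1 : EV R X1 Y i) (h2 : EV R X2 Y (i+1)) : EV R X3 Y (i+1) := by
  intro e
  obtain ⟨x, hx⟩ := Ext.contravariant_sequence_exact₃ (ses f g hf hg h) _ e (h2 _) (add_comm 1 i)
  rw [← hx, h1 x, Ext.comp_zero]

lemma contra2' (f : X1 →ₗ[R] X2) (g : X2 →ₗ[R] X3) (hf : Function.Injective f)
    (hg : Function.Surjective g) (h : Function.Exact f g)
    (h1 : ∀ u : X1 →ₗ[R] Y, ∃ v : X2 →ₗ[R] Y, v ∘ₗ f = u)
    (h2 : EV R X2 Y 1) : EV R X3 Y 1 := by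
  intro e
  obtain ⟨x, hx⟩ := Ext.contravariant_sequence_exact₃ (ses f g hf hg h) _ e (h2 _) (add_comm 1 0)
  obtain ⟨u, rfl⟩ := (Ext.mk₀_bijective _ _).2 x
  obtain ⟨v, hv⟩ := h1 u.hom
  have : u = ModuleCat.ofHom f ≫ ModuleCat.ofHom v := by
    ext x; exact (congrArg (fun w => w x) hv).symm
  rw [← hx, this, ← Ext.mk₀_comp_mk₀]
  exact (ses f g hf hg h).extClass_comp_assoc _

lemma contra3 (f : X1 →ₗ[R] X2) (g : X2 →ₗ[R] X3) (hf : Function.Injective f)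
    (hg : Function.Surjective g) (h : Function.Exact f g)
    (h3 : EV R X3 Y 1) (u : X1 →ₗ[R] Y) : ∃ v : X2 →ₗ[R] Y, v ∘ₗ f = u := by
  obtain ⟨x, hx⟩ := Ext.contravariant_sequence_exact₁ (ses f g hf hg h) _
    (Ext.mk₀ (ModuleCat.ofHom u)) (add_comm 1 0) (h3 _)
  obtain ⟨v, rfl⟩ := (Ext.mk₀_bijective _ _).2 x
  rw [Ext.mk₀_comp_mk₀] at hx
  have := (Ext.mk₀_bijective _ _).1 hx
  exact ⟨v.hom, congrArg ModuleCat.Hom.hom this⟩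

lemma cov1 (f : X1 →ₗ[R] X2) (g : X2 →ₗ[R] X3) (hf : Function.Injective f)
    (hg : Function.Surjective g) (h : Function.Exact f g)
    {i : ℕ} (h2 : EV R X X2 i) (h1 : EV R X X1 (i+1)) : EV R X X3 i := by
  intro e
  obtain ⟨x, hx⟩ := Ext.covariant_sequence_exact₃ _ (ses f g hf hg h) e rfl (h1 _)
  rw [← hx, h2 x, Ext.zero_comp]

lemma cov2 (f : X1 →ₗ[R] X2) (g : X2 →ₗ[R] X3) (hf : Function.Injective f)
    (hg : Function.Surjective g) (h : Function.Exact f g)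
    {i : ℕ} (h3 : EV R X X3 i) (h2 : EV R X X2 (i+1)) : EV R X X1 (i+1) := by
  intro e
  obtain ⟨x, hx⟩ := Ext.covariant_sequence_exact₁ _ (ses f g hf hg h) e (h2 _) rfl
  rw [← hx, h3 x, Ext.zero_comp]

lemma cov2' (f : X1 →ₗ[R] X2) (g : X2 →ₗ[R] X3) (hf : Function.Injective f)
    (hg : Function.Surjective g) (h : Function.Exact f g)
    (h3 : ∀ u : X →ₗ[R] X3, ∃ v : X →ₗ[R] X2, g ∘ₗ v = u)
    (h2 : EV R X X2 1) : EV R X X1 1 := by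
  intro e
  obtain ⟨x, hx⟩ := Ext.covariant_sequence_exact₁ _ (ses f g hf hg h) e (h2 _) (zero_add 1)
  obtain ⟨u, rfl⟩ := (Ext.mk₀_bijective _ _).2 x
  obtain ⟨v, hv⟩ := h3 u.hom
  have : u = ModuleCat.ofHom v ≫ ModuleCat.ofHom g := by
    ext x; exact (congrArg (fun w => w x) hv).symm
  rw [← hx, this, ← Ext.mk₀_comp_mk₀, Ext.comp_assoc_of_second_deg_zero]
  have := (ses f g hf hg h).comp_extClass
  dsimp only at this
  rw [this, Ext.comp_zero]

lemma cov3 (f : X1 →ₗ[R] X2) (g : X2 →ₗ[R] X3) (hf : Function.Injective f)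
    (hg : Function.Surjective g) (h : Function.Exact f g)
    (h1 : EV R X X1 1) (u : X →ₗ[R] X3) : ∃ v : X →ₗ[R] X2, g ∘ₗ v = u := by
  obtain ⟨x, hx⟩ := Ext.covariant_sequence_exact₃ _ (ses f g hf hg h)
    (Ext.mk₀ (ModuleCat.ofHom u)) (zero_add 1) (h1 _)
  obtain ⟨v, rfl⟩ := (Ext.mk₀_bijective _ _).2 x
  rw [Ext.mk₀_comp_mk₀] at hx
  have := (Ext.mk₀_bijective _ _).1 hx
  exact ⟨v.hom, congrArg ModuleCat.Hom.hom this⟩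
end

lemma ev_proj [Module.Projective R X] (i : ℕ) : EV R X Y (i+1) := by
  intro e
  have : Projective (ModuleCat.of R X) := (IsProjective.iff_projective X).1 inferInstance
  exact Ext.eq_zero_of_projective e

lemma ev_inj [Module.Injective R Y] (i : ℕ) : EV R X Y (i+1) := by
  intro e
  have : Injective (ModuleCat.of R Y) := Module.injective_object_of_injective_module R Y
  exact Ext.eq_zero_of_injective e

lemma ev_sub [Subsingleton X] (i : ℕ) : EV R X Y (i+1) := by
  have : Module.Projective R X := Module.Projective.of_free
  exact ev_proj i

end ExtBasics
end P17

namespace P17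
open CategoryTheory CategoryTheory.Abelian Paper

section Bridge
variable {R : Type} [Ring R]

lemma exact_ker {X Y : Type} [AddCommGroup X] [Module R X] [AddCommGroup Y] [Module R Y]
    (p : X →ₗ[R] Y) : Function.Exact (LinearMap.ker p).subtype p := by
  intro x; constructor
  · intro h; exact ⟨⟨x, h⟩, rfl⟩
  · rintro ⟨y, rfl⟩; exact y.2

lemma exact_quot {X Y : Type} [AddCommGroup X] [Module R X] [AddCommGroup Y] [Module R Y]
    (p : X →ₗ[R] Y) : Function.Exact p (LinearMap.range p).mkQ := by
  intro x
  simp only [Submodule.mkQ_apply, Submodule.Quotient.mk_eq_zero]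
  rfl

/-- Factor through a surjection. -/
lemma factor {X Y Z : Type} [AddCommGroup X] [Module R X] [AddCommGroup Y] [Module R Y]
    [AddCommGroup Z] [Module R Z] (p : X →ₗ[R] Y) (hp : Function.Surjective p) (f : X →ₗ[R] Z)
    (h : ∀ x, p x = 0 → f x = 0) : ∃ g : Y →ₗ[R] Z, g ∘ₗ p = f := by
  refine ⟨(LinearMap.ker p).liftQ f h ∘ₗ (p.quotKerEquivOfSurjective hp).symm.toLinearMap, ?_⟩
  ext x
  have : (p.quotKerEquivOfSurjective hp).symm (p x) = Submodule.Quotient.mk x := by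
    rw [LinearEquiv.symm_apply_eq]; rfl
  simp only [LinearMap.comp_apply, LinearEquiv.coe_coe, this]
  rfl

/-- The tail of a projective resolution. -/
def tail {X : ModuleCat.{0} R} (S : ProjRes R X) :
    ProjRes R (ModuleCat.of R (LinearMap.ker S.aug)) where
  P j := S.P (j+1)
  d j := S.d (j+1)
  aug := (S.d 0).codRestrict _ (fun x => S.exact0.apply_apply_eq_zero x)
  proj j := S.proj (j+1)
  augSurj := by
    rintro ⟨x, hx⟩
    obtain ⟨y, rfl⟩ := (S.exact0 x).1 hx
    exact ⟨y, rfl⟩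
  exact0 := by
    intro x
    rw [← S.exact 0 x]
    exact Subtype.ext_iff
  exact j := S.exact (j+1)

lemma bridge_aux (Y : ModuleCat.{0} R) (i : ℕ) : ∀ (X : ModuleCat.{0} R) (S : ProjRes R X),
    EV R X Y (i+1) ↔ ∀ f : S.P (i+1) →ₗ[R] Y,
      f ∘ₗ S.d (i+1) = 0 → ∃ g : S.P i →ₗ[R] Y, f = g ∘ₗ S.d i := by
  induction i with
  | zero =>
    intro X S
    have := S.proj 0
    have hk := exact_ker S.aug
    have hi := (LinearMap.ker S.aug).subtype_injective
    constructor
    · intro h f hf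
      obtain ⟨g, hg⟩ := factor (tail S).aug (tail S).augSurj f (by
        intro x hx
        obtain ⟨y, rfl⟩ := ((tail S).exact0 x).1 hx
        exact congrArg (fun w => w y) hf)
      obtain ⟨v, hv⟩ := contra3 _ _ hi S.augSurj hk h g
      refine ⟨v, ?_⟩
      rw [← hg, ← hv]; rfl
    · intro h
      refine contra2' _ _ hi S.augSurj hk ?_ (ev_proj 0)
      intro u
      obtain ⟨g, hg⟩ := h (u ∘ₗ (tail S).aug) (by
        ext x
        have : (tail S).aug (S.d 1 x) = 0 := ((tail S).exact0).apply_apply_eq_zero x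
        show u ((tail S).aug (S.d 1 x)) = 0
        rw [this, map_zero])
      refine ⟨g, ?_⟩
      ext x
      obtain ⟨y, rfl⟩ := (tail S).augSurj x
      exact (congrArg (fun w => w y) hg).symm
  | succ i ih =>
    intro X S
    have := S.proj 0
    have hk := exact_ker S.aug
    have hi := (LinearMap.ker S.aug).subtype_injective
    refine Iff.trans ?_ (ih _ (tail S))
    constructor
    · exact fun h => contra1 _ _ hi S.augSurj hk (ev_proj i) h
    · exact fun h => contra2 _ _ hi S.augSurj hk h (ev_proj (i+1))

/-- Iterated syzygies w.r.t. canonical free covers. -/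
noncomputable def freeSyz (X : ModuleCat.{0} R) : ℕ → ModuleCat.{0} R
  | 0 => X
  | j+1 => ModuleCat.of R (LinearMap.ker (Finsupp.linearCombination R (id : freeSyz X j → _)))

/-- The canonical free resolution. -/
noncomputable def freeRes (X : ModuleCat.{0} R) : ProjRes R X where
  P j := ModuleCat.of R (freeSyz X j →₀ R)
  d j := (LinearMap.ker (Finsupp.linearCombination R (id : freeSyz X j → _))).subtype ∘ₗ
    (Finsupp.linearCombination R (id : freeSyz X (j+1) → _))
  aug := (Finsupp.linearCombination R (id : X → X))
  proj j := inferInstanceAs (Module.Projective R (freeSyz X j →₀ R))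
  augSurj := Finsupp.linearCombination_id_surjective R _
  exact0 := by
    intro x
    constructor
    · intro h
      obtain ⟨y, hy⟩ := Finsupp.linearCombination_id_surjective R (freeSyz X 1) ⟨x, h⟩
      exact ⟨y, congrArg Subtype.val hy⟩
    · rintro ⟨y, rfl⟩
      exact (Finsupp.linearCombination R (id : freeSyz X 1 → _) y).2
  exact j := by
    intro x
    constructor
    · intro h
      have h' : Finsupp.linearCombination R (id : freeSyz X (j+1) → _) x = 0 := Subtype.ext h
      obtain ⟨y, hy⟩ := Finsupp.linearCombination_id_surjective R (freeSyz X (j+2)) ⟨x, h'⟩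
      exact ⟨y, congrArg Subtype.val hy⟩
    · rintro ⟨y, rfl⟩
      have := (Finsupp.linearCombination R (id : freeSyz X (j+2) → _) y).2
      exact congrArg Subtype.val this

lemma bridge (X Y : ModuleCat.{0} R) (i : ℕ) : ExtVanish R X Y (i+1) ↔ EV R X Y (i+1) := by
  constructor
  · intro h
    exact (bridge_aux Y i X (freeRes X)).2 (h (freeRes X))
  · intro h S
    exact (bridge_aux Y i X S).1 h

lemma bridge_range (X Y : ModuleCat.{0} R) (p : ℕ) :
    (∀ i, 1 ≤ i → i ≤ p → ExtVanish R X Y i) ↔ (∀ i, i < p → EV R X Y (i+1)) := by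
  constructor
  · intro h i hi
    exact (bridge X Y i).1 (h _ (by omega) (by omega))
  · intro h i h1 hi
    obtain ⟨i, rfl⟩ : ∃ j, i = j + 1 := ⟨i-1, by omega⟩
    exact (bridge X Y i).2 (h i (by omega))

lemma pd_ev (Y : ModuleCat.{0} R) (n : ℕ) : ∀ (X : ModuleCat.{0} R), pdLE R X n →
    ∀ i, n < i → EV R X Y i := by
  induction n with
  | zero =>
    rintro X ⟨P, d, aug, hP, hs, hsurj, he0, he, -⟩ i hi
    obtain ⟨i, rfl⟩ : ∃ j, i = j + 1 := ⟨i-1, by omega⟩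
    have := hP 0 le_rfl
    have h1 := hs 1 (by omega)
    refine ev_equiv_left (X1 := P 0) (LinearEquiv.ofBijective aug ⟨?_, hsurj⟩).symm (ev_proj i)
    rw [← LinearMap.ker_eq_bot, LinearMap.ker_eq_bot']
    intro x hx
    obtain ⟨y, rfl⟩ := (he0 x).1 hx
    rw [Subsingleton.elim y 0, map_zero]
  | succ n ih =>
    rintro X ⟨P, d, aug, hP, hs, hsurj, he0, he, -⟩ i hi
    obtain ⟨i, rfl⟩ : ∃ j, i = j + 1 := ⟨i-1, by omega⟩
    have := hP 0 (by omega)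
    refine contra2 _ _ (LinearMap.ker aug).subtype_injective hsurj (exact_ker aug) ?_ (ev_proj i)
    refine ih (ModuleCat.of R (LinearMap.ker aug)) ⟨fun j => P (j+1), fun j => d (j+1),
      (d 0).codRestrict _ (fun x => he0.apply_apply_eq_zero x), fun j hj => hP _ (by omega),
      fun j hj => hs _ (by omega), ?_, ?_, fun j => he (j+1), ?_, ?_, ?_⟩ i (by omega)
    · rintro ⟨x, hx⟩
      obtain ⟨y, rfl⟩ := (he0 x).1 hx
      exact ⟨y, rfl⟩
    · intro x
      rw [← he 0 x]
      exact Subtype.ext_iff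
    · intro f
      refine ⟨0, ?_⟩
      ext x; rw [show x = 0 from Subsingleton.elim (α := PUnit) _ _]; simp
    · intro f _
      refine ⟨0, ?_⟩
      ext x; rw [show x = 0 from Subsingleton.elim (α := PUnit) _ _]; simp
    · intro j f _
      refine ⟨0, ?_⟩
      ext x; rw [show x = 0 from Subsingleton.elim (α := PUnit) _ _]; simp

lemma id_ev (X : ModuleCat.{0} R) (n : ℕ) : ∀ (Y : ModuleCat.{0} R), idLE R Y n →
    ∀ i, n < i → EV R X Y i := by
  induction n with
  | zero =>
    rintro Y ⟨M, ι, d, hP, hs, hinj, he0, he, -⟩ i hi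
    obtain ⟨i, rfl⟩ : ∃ j, i = j + 1 := ⟨i-1, by omega⟩
    have := hP 0 le_rfl
    have h1 := hs 1 (by omega)
    refine ev_equiv_right (Y1 := M 0) (LinearEquiv.ofBijective ι ⟨hinj, ?_⟩) (ev_inj i)
    intro x
    exact (he0 x).1 (Subsingleton.elim _ _)
  | succ n ih =>
    rintro Y ⟨M, ι, d, hP, hs, hinj, he0, he, -⟩ i hi
    obtain ⟨i, rfl⟩ : ∃ j, i = j + 1 := ⟨i-1, by omega⟩
    have := hP 0 (by omega)
    refine cov2 _ _ hinj (Submodule.mkQ_surjective _) (exact_quot ι) ?_ (ev_inj i)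
    refine ih (ModuleCat.of R (M 0 ⧸ LinearMap.range ι)) ⟨fun j => M (j+1),
      (LinearMap.range ι).liftQ (d 0) (by rintro _ ⟨y, rfl⟩; exact he0.apply_apply_eq_zero y),
      fun j => d (j+1), fun j hj => hP _ (by omega),
      fun j hj => hs _ (by omega), ?_, ?_, fun j => he (j+1), ?_, ?_, ?_⟩ i (by omega)
    · rw [← LinearMap.ker_eq_bot, LinearMap.ker_eq_bot']
      intro x hx
      obtain ⟨y, rfl⟩ := Submodule.mkQ_surjective _ x
      obtain ⟨z, rfl⟩ := (he0 y).1 hx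
      simp
    · intro x
      rw [he 0 x]
      constructor
      · rintro ⟨y, rfl⟩; exact ⟨Submodule.mkQ _ y, rfl⟩
      · rintro ⟨y, rfl⟩
        obtain ⟨y, rfl⟩ := Submodule.mkQ_surjective _ y
        exact ⟨y, rfl⟩
    all_goals intros; exact ⟨0, LinearMap.ext fun _ => Subsingleton.elim (α := PUnit) _ _⟩

lemma pd_zero (X : ModuleCat.{0} R) (h : Module.Projective R X) : pdLE R X 0 := by
  refine ⟨fun | 0 => X | j+1 => ModuleCat.of R PUnit, fun _ => 0, LinearMap.id, ?_, ?_,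
    Function.surjective_id, ?_, ?_, ?_, ?_, ?_⟩
  · intro j hj
    obtain rfl : j = 0 := by omega
    exact h
  · intro j hj
    obtain ⟨j, rfl⟩ : ∃ i, j = i + 1 := ⟨j-1, by omega⟩
    exact inferInstanceAs (Subsingleton PUnit)
  · intro x; constructor
    · intro h; exact ⟨0, h.symm⟩
    · rintro ⟨y, rfl⟩; rfl
  · intro j x; constructor
    · intro h; exact ⟨0, Subsingleton.elim (α := PUnit) _ _⟩
    · intro _; rfl
  all_goals
    intros
    refine ⟨0, ?_⟩
    refine LinearMap.ext fun x => ?_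
    rw [show x = 0 from Subsingleton.elim (α := PUnit) _ _]
    try simp

lemma pd_succ {X P : ModuleCat.{0} R} (hP : Module.Projective R P) (p : P →ₗ[R] X)
    (hp : Function.Surjective p) (n : ℕ) (h : pdLE R (ModuleCat.of R (LinearMap.ker p)) n) :
    pdLE R X (n+1) := by
  obtain ⟨P', d, aug, hP', hs, hsurj, he0, he, -⟩ := h
  refine ⟨fun | 0 => P | j+1 => P' j, fun | 0 => (LinearMap.ker p).subtype ∘ₗ aug | j+1 => d j,
    p, ?_, ?_, hp, ?_, ?_, ?_, ?_, ?_⟩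
  · rintro (_ | j) hj
    · exact hP
    · exact hP' j (by omega)
  · rintro (_ | j) hj
    · omega
    · exact hs j (by omega)
  · intro x; constructor
    · intro h
      obtain ⟨y, hy⟩ := hsurj ⟨x, h⟩
      exact ⟨y, congrArg Subtype.val hy⟩
    · rintro ⟨y, rfl⟩; exact (aug y).2
  · rintro (_ | j)
    · intro x
      rw [← he0 x]
      exact (Subtype.ext_iff (a1 := aug x) (a2 := 0)).symm
    · exact he j
  all_goals
    intros
    refine ⟨0, ?_⟩
    ext x; rw [show x = 0 from Subsingleton.elim (α := PUnit) _ _]; simp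

end Bridge
end P17

namespace P17
open CategoryTheory CategoryTheory.Abelian Paper

set_option linter.unusedSectionVars false
section Dual
variable {A E Q : Type} [Ring A] [Ring E] [AddCommGroup Q] [Module A Q] [Module E Q]
  [SMulCommClass A E Q] [SMulCommClass E A Q]
variable {X Y M K : Type} [AddCommGroup X] [Module A X] [AddCommGroup Y] [Module A Y]
  [AddCommGroup M] [Module A M] [AddCommGroup K] [Module A K]

/-- Precomposition, as an `E`-linear map. -/
def pre (E Q : Type) [Ring E] [AddCommGroup Q] [Module A Q] [Module E Q] [SMulCommClass A E Q]
    (f : X →ₗ[A] Y) : (Y →ₗ[A] Q) →ₗ[E] (X →ₗ[A] Q) where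
  toFun h := h ∘ₗ f
  map_add' _ _ := rfl
  map_smul' _ _ := rfl

/-- Evaluation into the double dual. -/
def dbl (A E Q X : Type) [Ring A] [Ring E] [AddCommGroup Q] [Module A Q] [Module E Q]
    [SMulCommClass A E Q] [SMulCommClass E A Q] [AddCommGroup X] [Module A X] :
    X →ₗ[A] ((X →ₗ[A] Q) →ₗ[E] Q) where
  toFun x :=
    { toFun := fun f => f x
      map_add' := fun _ _ => rfl
      map_smul' := fun _ _ => rfl }
  map_add' x y := by ext f; exact map_add f x y
  map_smul' a x := by ext f; exact map_smul f a x

lemma dbl_inj_iff : Function.Injective (dbl A E Q X) ↔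
    ∀ x : X, (∀ f : X →ₗ[A] Q, f x = 0) → x = 0 := by
  rw [← LinearMap.ker_eq_bot, LinearMap.ker_eq_bot']
  constructor
  · intro h x hx
    exact h x (LinearMap.ext hx)
  · intro h x hx
    exact h x (fun f => congrArg (fun w => w f) hx)

lemma dbl_inj_sub (ι : X →ₗ[A] Y) (hι : Function.Injective ι)
    (h : Function.Injective (dbl A E Q Y)) : Function.Injective (dbl A E Q X) := by
  rw [dbl_inj_iff] at h ⊢
  intro x hx
  apply hι
  rw [map_zero]
  exact h _ (fun f => hx (f ∘ₗ ι))

lemma dbl_retract (s : X →ₗ[A] Y) (r : Y →ₗ[A] X) (hrs : r ∘ₗ s = LinearMap.id)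
    (h : Function.Bijective (dbl A E Q Y)) : Function.Bijective (dbl A E Q X) := by
  have hr : ∀ x, r (s x) = x := fun x => congrArg (fun w => w x) hrs
  refine ⟨dbl_inj_sub s (Function.LeftInverse.injective hr) h.1, ?_⟩
  intro φ
  obtain ⟨y, hy⟩ := h.2 (φ ∘ₗ pre E Q s)
  refine ⟨r y, ?_⟩
  ext f
  have := congrArg (fun w => w (f ∘ₗ r)) hy
  change f (r y) = φ ((f ∘ₗ r) ∘ₗ s) at this
  rw [LinearMap.comp_assoc, hrs, LinearMap.comp_id] at this
  exact this

lemma dbl_pi (n : ℕ) (h : Function.Bijective (dbl A E Q X)) :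
    Function.Bijective (dbl A E Q (Fin n → X)) := by
  constructor
  · have h1 := h.1
    rw [dbl_inj_iff] at h1 ⊢
    intro v hv
    ext k
    exact h1 _ (fun f => hv (f ∘ₗ LinearMap.proj k))
  · intro φ
    choose v hv using fun k : Fin n => h.2 (φ ∘ₗ pre E Q (LinearMap.proj k))
    refine ⟨v, ?_⟩
    ext f
    have hf : f = ∑ k, (f ∘ₗ LinearMap.single A (fun _ => X) k) ∘ₗ LinearMap.proj k := by
      refine LinearMap.ext fun w => ?_
      rw [LinearMap.sum_apply]
      simp only [LinearMap.comp_apply, LinearMap.proj_apply]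
      rw [← map_sum]
      congr 1
      exact (LinearMap.sum_single_apply (fun _ => X) w).symm
    have h2 : ∀ k, φ ((f ∘ₗ LinearMap.single A (fun _ => X) k) ∘ₗ LinearMap.proj k)
        = ((f ∘ₗ LinearMap.single A (fun _ => X) k) ∘ₗ LinearMap.proj k) v := by
      intro k
      exact (congrArg (fun w => w (f ∘ₗ LinearMap.single A (fun _ => X) k)) (hv k)).symm
    change f v = φ f
    rw [hf, map_sum, LinearMap.sum_apply]
    exact Finset.sum_congr rfl (fun k _ => (h2 k).symm)

lemma dbl_add {Q1 M : ModuleCat.{0} A} (hM : InAdd A Q1 M)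
    (h : Function.Bijective (dbl A E Q Q1)) : Function.Bijective (dbl A E Q M) := by
  obtain ⟨n, s, r, hrs⟩ := hM
  exact dbl_retract s r hrs (dbl_pi n h)

lemma dbl_ker (ι : Y →ₗ[A] M) (π : M →ₗ[A] K) (hι : Function.Injective ι)
    (hex : Function.Exact ι π) (hext : ∀ u : Y →ₗ[A] Q, ∃ v : M →ₗ[A] Q, v ∘ₗ ι = u)
    (hM : Function.Bijective (dbl A E Q M)) (hK : Function.Injective (dbl A E Q K)) :
    Function.Bijective (dbl A E Q Y) := by
  refine ⟨dbl_inj_sub ι hι hM.1, ?_⟩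
  intro φ
  obtain ⟨μ, hμ⟩ := hM.2 (φ ∘ₗ pre E Q ι)
  have hμ' : ∀ v : M →ₗ[A] Q, v μ = φ (v ∘ₗ ι) := fun v => congrArg (fun w => w v) hμ
  have h0 : π μ = 0 := by
    rw [dbl_inj_iff] at hK
    apply hK
    intro f
    have := hμ' (f ∘ₗ π)
    rw [LinearMap.comp_assoc, hex.linearMap_comp_eq_zero, LinearMap.comp_zero, map_zero] at this
    exact this
  obtain ⟨y, rfl⟩ := (hex μ).1 h0
  refine ⟨y, ?_⟩
  ext u
  obtain ⟨v, rfl⟩ := hext u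
  exact hμ' v

section
variable (E)

lemma pre_inj (π : M →ₗ[A] K) (hπ : Function.Surjective π) : Function.Injective (pre E Q π) := by
  intro u v h
  ext x
  obtain ⟨y, rfl⟩ := hπ x
  exact congrArg (fun w => w y) h

lemma pre_exact (ι : Y →ₗ[A] M) (π : M →ₗ[A] K) (hπ : Function.Surjective π)
    (hex : Function.Exact ι π) :
    Function.Exact (pre E Q π) (pre E Q ι) := by
  intro u
  constructor
  · intro h
    obtain ⟨g, hg⟩ := factor π hπ u (by
      intro x hx
      obtain ⟨y, rfl⟩ := (hex x).1 hx
      exact congrArg (fun w => w y) h)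
    exact ⟨g, hg⟩
  · rintro ⟨v, rfl⟩
    change (v ∘ₗ π) ∘ₗ ι = 0
    rw [LinearMap.comp_assoc, hex.linearMap_comp_eq_zero, LinearMap.comp_zero]
end

/-- One step of dimension shifting on the dual side, degree one. -/
lemma dual_ext_one (ι : Y →ₗ[A] M) (π : M →ₗ[A] K) (hπ : Function.Surjective π)
    (hex : Function.Exact ι π) (hext : ∀ u : Y →ₗ[A] Q, ∃ v : M →ₗ[A] Q, v ∘ₗ ι = u)
    (hK : Function.Surjective (dbl A E Q K)) (hM : EV E (M →ₗ[A] Q) Q 1) :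
    EV E (Y →ₗ[A] Q) Q 1 := by
  refine contra2' (pre E Q π) (pre E Q ι) (pre_inj E π hπ) hext (pre_exact E ι π hπ hex) ?_ hM
  intro u
  obtain ⟨x, rfl⟩ := hK u
  obtain ⟨y, rfl⟩ := hπ x
  exact ⟨dbl A E Q M y, rfl⟩

lemma dual_ext_succ (ι : Y →ₗ[A] M) (π : M →ₗ[A] K) (hπ : Function.Surjective π)
    (hex : Function.Exact ι π) (hext : ∀ u : Y →ₗ[A] Q, ∃ v : M →ₗ[A] Q, v ∘ₗ ι = u) (i : ℕ)
    (hK : EV E (K →ₗ[A] Q) Q i) (hM : EV E (M →ₗ[A] Q) Q (i+1)) :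
    EV E (Y →ₗ[A] Q) Q (i+1) :=
  contra2 (pre E Q π) (pre E Q ι) (pre_inj E π hπ) hext (pre_exact E ι π hπ hex) hK hM

end Dual

section Add
variable {R : Type} [Ring R]

lemma inAdd_equiv {Q X X' : ModuleCat.{0} R} (e : X ≃ₗ[R] X') (h : InAdd R Q X) :
    InAdd R Q X' := by
  obtain ⟨n, s, r, h⟩ := h
  refine ⟨n, s ∘ₗ e.symm.toLinearMap, e.toLinearMap ∘ₗ r, ?_⟩
  ext x
  have := congrArg (fun w => w (e.symm x)) h
  simp only [LinearMap.comp_apply, LinearMap.id_apply] at this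
  simp [this]

lemma inAdd_equiv' {Q Q' X : ModuleCat.{0} R} (e : Q ≃ₗ[R] Q') (h : InAdd R Q X) :
    InAdd R Q' X := by
  obtain ⟨n, s, r, h⟩ := h
  refine ⟨n, (LinearEquiv.piCongrRight (fun _ : Fin n => e)).toLinearMap ∘ₗ s,
    r ∘ₗ (LinearEquiv.piCongrRight (fun _ : Fin n => e)).symm.toLinearMap, ?_⟩
  rw [← h]
  ext x
  simp only [LinearMap.comp_apply, LinearEquiv.coe_coe, LinearEquiv.symm_apply_apply]

lemma inAdd_pi (Q : ModuleCat.{0} R) (n : ℕ) : InAdd R Q (ModuleCat.of R (Fin n → Q)) :=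
  ⟨n, LinearMap.id, LinearMap.id, rfl⟩

lemma inAdd_retract {Q X X' : ModuleCat.{0} R} (s : X →ₗ[R] X') (r : X' →ₗ[R] X)
    (hrs : r ∘ₗ s = LinearMap.id) (h : InAdd R Q X') : InAdd R Q X := by
  obtain ⟨n, s', r', h⟩ := h
  refine ⟨n, s' ∘ₗ s, r ∘ₗ r', ?_⟩
  rw [← hrs]
  ext x
  have := congrArg (fun w => w (s x)) h
  simp only [LinearMap.comp_apply, LinearMap.id_apply] at this
  simp [this]

lemma inAdd_finite {Q X : ModuleCat.{0} R} (hQ : Module.Finite R Q) (h : InAdd R Q X) :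
    Module.Finite R X := by
  obtain ⟨n, s, r, h⟩ := h
  refine Module.Finite.of_surjective r ?_
  intro x
  exact ⟨s x, congrArg (fun w => w x) h⟩

lemma inAdd_proj {X : ModuleCat.{0} R} (h : InAdd R (ModuleCat.of R R) X) :
    Module.Projective R X := by
  obtain ⟨n, s, r, h⟩ := h
  exact Module.Projective.of_split (M := Fin n → R) s r h

/-- Over the ring, `X` finitely generated with `Ext^1(X, Z) = 0` for f.g. `Z` is in `add R`. -/
lemma inAdd_of_lift {X Q : ModuleCat.{0} R} {M : Type} [AddCommGroup M] [Module R M]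
    (hM : InAdd R Q (ModuleCat.of R M)) (p : M →ₗ[R] X)
    (h : ∃ v : X →ₗ[R] M, p ∘ₗ v = LinearMap.id) : InAdd R Q X := by
  obtain ⟨v, hv⟩ := h
  exact inAdd_retract (X' := ModuleCat.of R M) v p hv hM

end Add

section DualAdd
variable {A E Q : Type} [Ring A] [Ring E] [AddCommGroup Q] [Module A Q] [Module E Q]
  [SMulCommClass A E Q]

lemma inAdd_dual {Q1 M : ModuleCat.{0} A} (h : InAdd A Q1 M) :
    InAdd E (ModuleCat.of E (Q1 →ₗ[A] Q)) (ModuleCat.of E (M →ₗ[A] Q)) := by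
  obtain ⟨n, s, r, h⟩ := h
  let L := LinearMap.lsum A (fun _ : Fin n => Q1) (M := Q) E
  refine ⟨n, L.symm.toLinearMap ∘ₗ pre E Q r, pre E Q s ∘ₗ L.toLinearMap, ?_⟩
  ext f x
  simp only [LinearMap.comp_apply, LinearEquiv.coe_coe, LinearEquiv.apply_symm_apply]
  have := congrArg (fun w => f (w x)) h
  exact this

lemma inAdd_dual_free (n : ℕ) :
    InAdd E (ModuleCat.of E Q) (ModuleCat.of E ((Fin n → A) →ₗ[A] Q)) :=
  inAdd_equiv (X := ModuleCat.of E (Fin n → Q)) (LinearEquiv.piRing A Q (Fin n) E).symm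
    (inAdd_pi (ModuleCat.of E Q) n)

lemma inAdd_dual_ring {M : ModuleCat.{0} A} (h : InAdd A (ModuleCat.of A A) M) :
    InAdd E (ModuleCat.of E Q) (ModuleCat.of E (M →ₗ[A] Q)) :=
  inAdd_equiv' (Q := ModuleCat.of E (A →ₗ[A] Q)) (Q' := ModuleCat.of E Q)
    (LinearMap.ringLmapEquivSelf A E Q) (inAdd_dual h)

end DualAdd
end P17

set_option linter.unusedSectionVars false
namespace P17
open CategoryTheory CategoryTheory.Abelian Paper

section DDsec
variable {A : Type} [Ring A]

/-- Recursive form of relative dominant dimension. -/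
def DD (Q : ModuleCat.{0} A) : ℕ → ModuleCat.{0} A → Prop
  | 0, _ => True
  | n+1, X => ∃ (M : ModuleCat.{0} A) (ι : X →ₗ[A] M), InAdd A Q M ∧ Function.Injective ι ∧
      (∀ u : X →ₗ[A] Q, ∃ v : M →ₗ[A] Q, v ∘ₗ ι = u) ∧
      DD Q n (ModuleCat.of A (M ⧸ LinearMap.range ι))

lemma DD_of_domdim (Q : ModuleCat.{0} A) (n : ℕ) : ∀ X, domdimGE A Q X n → DD Q n X := by
  induction n with
  | zero => intro X _; trivial
  | succ n ih =>
    rintro X (h | ⟨M, ι, d, hM, hι, h0, he, hx, hx0, hxe⟩)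
    · omega
    refine ⟨M 0, ι, hM 0 (by omega), hι, hx, ih _ ?_⟩
    rcases Nat.eq_zero_or_pos n with hn | hn
    · exact Or.inl hn
    right
    have h0' := h0 (by omega)
    refine ⟨fun j => M (j+1),
      (LinearMap.range ι).liftQ (d 0) (by rintro _ ⟨y, rfl⟩; exact h0'.apply_apply_eq_zero y),
      fun j => d (j+1), fun j hj => hM _ (by omega), ?_, ?_, fun j hj => he (j+1) (by omega),
      ?_, ?_, fun j hj => hxe (j+1) (by omega)⟩
    · rw [← LinearMap.ker_eq_bot, LinearMap.ker_eq_bot']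
      intro x hx
      obtain ⟨y, rfl⟩ := Submodule.mkQ_surjective _ x
      obtain ⟨z, rfl⟩ := (h0' y).1 hx
      simp
    · intro hn x
      rw [he 0 (by omega) x]
      constructor
      · rintro ⟨y, rfl⟩; exact ⟨Submodule.mkQ _ y, rfl⟩
      · rintro ⟨y, rfl⟩
        obtain ⟨y, rfl⟩ := Submodule.mkQ_surjective _ y
        exact ⟨y, rfl⟩
    · intro f
      obtain ⟨h, hh⟩ := hx0 (by omega) (f ∘ₗ Submodule.mkQ _) (by
        ext x
        have : (LinearMap.range ι).mkQ (ι x) = 0 := (exact_quot ι).apply_apply_eq_zero x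
        show f ((LinearMap.range ι).mkQ (ι x)) = 0
        rw [this, map_zero])
      refine ⟨h, ?_⟩
      refine LinearMap.ext fun x => ?_
      obtain ⟨y, rfl⟩ := Submodule.mkQ_surjective _ x
      exact congrArg (fun w => w y) hh
    · intro hn f hf
      refine hxe 0 (by omega) f ?_
      refine LinearMap.ext fun y => ?_
      exact congrArg (fun w => w (Submodule.mkQ _ y)) hf

/-- `j`-fold cosyzygy chain in `add Q`. -/
def Cosyz (Q : ModuleCat.{0} A) : ℕ → ModuleCat.{0} A → Prop
  | 0, Y => Module.Finite A Y
  | j+1, Y => ∃ (M : ModuleCat.{0} A) (ι : Y →ₗ[A] M), InAdd A Q M ∧ Function.Injective ι ∧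
      Cosyz Q j (ModuleCat.of A (M ⧸ LinearMap.range ι))

lemma cosyz_equiv (Q : ModuleCat.{0} A) (j : ℕ) (Y Y' : ModuleCat.{0} A) (e : Y ≃ₗ[A] Y')
    (h : Cosyz Q j Y) : Cosyz Q j Y' := by
  induction j generalizing Y Y' with
  | zero =>
    have : Module.Finite A Y := h
    exact Module.Finite.equiv e
  | succ j ih =>
    obtain ⟨M, ι, hM, hι, hc⟩ := h
    refine ⟨M, ι ∘ₗ e.symm.toLinearMap, hM, hι.comp e.symm.injective, ih _ _ ?_ hc⟩
    refine Submodule.quotEquivOfEq _ _ ?_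
    rw [LinearMap.range_comp, LinearEquiv.range, Submodule.map_top]

lemma cosyz_mk (Q : ModuleCat.{0} A) {j : ℕ} {Y M K : Type} [AddCommGroup Y] [Module A Y]
    [AddCommGroup M] [Module A M] [AddCommGroup K] [Module A K]
    (ι : Y →ₗ[A] M) (π : M →ₗ[A] K) (hι : Function.Injective ι)
    (hπ : Function.Surjective π) (hex : Function.Exact ι π) (hM : InAdd A Q (ModuleCat.of A M))
    (hK : Cosyz Q j (ModuleCat.of A K)) : Cosyz Q (j+1) (ModuleCat.of A Y) := by
  refine ⟨ModuleCat.of A M, ι, hM, hι, cosyz_equiv Q j _ _ ?_ hK⟩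
  refine ((Submodule.quotEquivOfEq _ _ ?_).trans (π.quotKerEquivOfSurjective hπ)).symm
  exact hex.linearMap_ker_eq.symm

lemma cosyz_ev (Q : ModuleCat.{0} A) (Z : Type) [AddCommGroup Z] [Module A Z] (j : ℕ) :
    ∀ (i : ℕ) (Y : ModuleCat.{0} A), Cosyz Q j Y →
    (∀ C : ModuleCat.{0} A, Module.Finite A C → EV A C Z (i+j)) →
    (∀ t, t < j → EV A Q Z (i+t)) → EV A Y Z i := by
  induction j with
  | zero => intro i Y hY hC _; exact hC Y hY
  | succ j ih =>
    rintro i Y ⟨M, ι, hM, hι, hc⟩ hC hQ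
    refine contra1 ι (LinearMap.range ι).mkQ hι (Submodule.mkQ_surjective _) (exact_quot ι)
      (ev_add_left hM (hQ 0 (by omega))) ?_
    refine ih (i+1) _ hc (fun C hCf => ?_) (fun t ht => ?_)
    · have := hC C hCf
      rwa [show i + 1 + j = i + (j+1) by omega]
    · have := hQ (t+1) (by omega)
      rwa [show i + 1 + t = i + (t+1) by omega]

end DDsec

section Main
variable {A E Q : Type} [Ring A] [Ring E] [AddCommGroup Q] [Module A Q] [Module E Q]
  [SMulCommClass A E Q] [SMulCommClass E A Q]

lemma DD_tors (hQ : Function.Bijective (dbl A E Q Q)) (n : ℕ) (X : ModuleCat.{0} A)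
    (h : DD (ModuleCat.of A Q) (n+1) X) : Function.Injective (dbl A E Q X) := by
  obtain ⟨M, ι, hM, hι, -⟩ := h
  exact dbl_inj_sub ι hι (dbl_add hM hQ).1

lemma DD_refl (hQ : Function.Bijective (dbl A E Q Q)) (n : ℕ) (X : ModuleCat.{0} A)
    (h : DD (ModuleCat.of A Q) (n+2) X) : Function.Bijective (dbl A E Q X) := by
  obtain ⟨M, ι, hM, hι, hx, h⟩ := h
  exact dbl_ker ι (LinearMap.range ι).mkQ hι (exact_quot ι) hx (dbl_add hM hQ)
    (DD_tors hQ n _ h)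

lemma DD_ext (hQ : Function.Bijective (dbl A E Q Q)) (hP : Module.Projective E (Q →ₗ[A] Q))
    (i : ℕ) : ∀ (j : ℕ) (X : ModuleCat.{0} A), i < j →
    DD (ModuleCat.of A Q) (j+2) X → EV E (X →ₗ[A] Q) Q (i+1) := by
  induction i with
  | zero =>
    rintro j X hj ⟨M, ι, hM, hι, hx, h⟩
    obtain ⟨j, rfl⟩ : ∃ j', j = j' + 1 := ⟨j-1, by omega⟩
    exact dual_ext_one ι _ (Submodule.mkQ_surjective _) (exact_quot ι) hx
      (DD_refl hQ _ _ h).2 (ev_add_left (inAdd_dual hM) (ev_proj 0))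
  | succ i ih =>
    rintro j X hj ⟨M, ι, hM, hι, hx, h⟩
    obtain ⟨j, rfl⟩ : ∃ j', j = j' + 1 := ⟨j-1, by omega⟩
    exact dual_ext_succ ι _ (Submodule.mkQ_surjective _) (exact_quot ι) hx _
      (ih j _ (by omega) h) (ev_add_left (inAdd_dual hM) (ev_proj _))

/-- The homothety map `A → End_E(Q)`. -/
def cmap (A E Q : Type) [Ring A] [Ring E] [AddCommGroup Q] [Module A Q] [Module E Q]
    [SMulCommClass A E Q] [SMulCommClass E A Q] : A →ₗ[A] (Q →ₗ[E] Q) where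
  toFun a :=
    { toFun := fun q => a • q
      map_add' := fun x y => smul_add a x y
      map_smul' := fun e q => smul_comm a e q }
  map_add' a b := by ext q; exact add_smul a b q
  map_smul' a b := by ext q; exact mul_smul a b q

lemma cmap_bij (h : Function.Bijective (dbl A E Q A)) : Function.Bijective (cmap A E Q) := by
  constructor
  · have h1 := (dbl_inj_iff (E := E)).1 h.1
    rw [← LinearMap.ker_eq_bot, LinearMap.ker_eq_bot']
    intro a ha
    apply h1
    intro f
    have : f a = a • f 1 := by rw [← map_smul, smul_eq_mul, mul_one]
    rw [this]
    exact congrArg (fun w => w (f 1)) ha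
  · intro φ
    obtain ⟨a, ha⟩ := h.2 (φ ∘ₗ (LinearMap.ringLmapEquivSelf A E Q).toLinearMap)
    refine ⟨a, ?_⟩
    ext q
    have := congrArg (fun w => w (LinearMap.toSpanSingleton A Q q)) ha
    simpa [dbl, cmap] using this

variable [IsNoetherianRing A] [IsNoetherianRing E]

lemma free_cover {R X : Type} [Ring R] [AddCommGroup X] [Module R X]
    [hX : Module.Finite R X] : ∃ (s : ℕ) (p : (Fin s → R) →ₗ[R] X), Function.Surjective p :=
  Module.Finite.exists_fin' R X

lemma dual_finite {X : Type} [AddCommGroup X] [Module E X] [Module.Finite E X]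
    [Module.Finite A Q] : Module.Finite A (X →ₗ[E] Q) := by
  obtain ⟨s, p, hp⟩ := free_cover (R := E) (X := X)
  have : Module.Finite A ((Fin s → E) →ₗ[E] Q) :=
    Module.Finite.equiv (LinearEquiv.piRing E Q (Fin s) A).symm
  exact Module.Finite.of_injective (pre A Q p) (pre_inj A p hp)

lemma cosyz_range [Module.Finite A Q] (q : ℕ) : ∀ (X : Type) [AddCommGroup X] [Module E X]
    [Module.Finite E X] (r : ℕ) (p : (Fin r → E) →ₗ[E] X), Function.Surjective p →
    (∀ i, i < q → EV E X Q (i+1)) →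
    Cosyz (ModuleCat.of A Q) (q+1) (ModuleCat.of A (LinearMap.range
      (pre A Q (LinearMap.ker p).subtype))) := by
  induction q with
  | zero =>
    intro X _ _ _ r p hp _
    obtain ⟨s, p1, hp1⟩ := free_cover (R := E) (X := LinearMap.ker p)
    refine ⟨ModuleCat.of A ((Fin s → E) →ₗ[E] Q), pre A Q p1 ∘ₗ Submodule.subtype _,
      inAdd_dual_free s, (pre_inj A p1 hp1).comp (Submodule.subtype_injective _), ?_⟩
    have : Module.Finite A ((Fin s → E) →ₗ[E] Q) := dual_finite
    exact Module.Finite.quotient A _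
  | succ q ih =>
    intro X _ _ _ r p hp hX
    have hext := contra3 _ _ (LinearMap.ker p).subtype_injective hp (exact_ker p)
      (hX 0 (by omega))
    have htop : LinearMap.range (pre A Q (LinearMap.ker p).subtype) = ⊤ :=
      LinearMap.range_eq_top.2 hext
    obtain ⟨s, p1, hp1⟩ := free_cover (R := E) (X := LinearMap.ker p)
    have hK : ∀ i, i < q → EV E (LinearMap.ker p) Q (i+1) := fun i hi =>
      contra1 _ _ (LinearMap.ker p).subtype_injective hp (exact_ker p)
        (ev_proj i) (hX (i+1) (by omega))
    have hc := ih (LinearMap.ker p) s p1 hp1 hK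
    have h1 : Cosyz (ModuleCat.of A Q) (q+1+1) (ModuleCat.of A (LinearMap.ker p →ₗ[E] Q)) := by
      refine cosyz_mk _ (pre A Q p1) (pre A Q (LinearMap.ker p1).subtype).rangeRestrict
        (pre_inj A p1 hp1) (LinearMap.surjective_rangeRestrict _) ?_ (inAdd_dual_free s) hc
      intro x
      rw [← pre_exact A _ _ hp1 (exact_ker p1) x]
      exact Subtype.ext_iff
    refine cosyz_equiv _ _ _ _ ?_ h1
    exact (LinearEquiv.ofTop _ htop).symm

lemma cosyz_dual [Module.Finite A Q] (q : ℕ) (X : Type) [AddCommGroup X] [Module E X]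
    [Module.Finite E X] (hX : ∀ i, i < q → EV E X Q (i+1)) :
    Cosyz (ModuleCat.of A Q) (q+2) (ModuleCat.of A (X →ₗ[E] Q)) := by
  obtain ⟨s, p, hp⟩ := free_cover (R := E) (X := X)
  refine cosyz_mk _ (pre A Q p) (pre A Q (LinearMap.ker p).subtype).rangeRestrict
    (pre_inj A p hp) (LinearMap.surjective_rangeRestrict _) ?_ (inAdd_dual_free s)
    (cosyz_range q X s p hp hX)
  intro x
  rw [← pre_exact A _ _ hp (exact_ker p) x]
  exact Subtype.ext_iff

lemma dual_surj [Module.Finite A Q] (hEE : Function.Bijective (dbl E A Q E)) (m q : ℕ)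
    (hmq : m ≤ q + 1)
    (hid : ∀ (C : ModuleCat.{0} A) i, m < i → EV A C Q i) (hso : ∀ i, EV A Q Q (i+1))
    (X : Type) [AddCommGroup X] [Module E X]
    [Module.Finite E X] (hX : ∀ i, i < q → EV E X Q (i+1)) :
    Function.Surjective (dbl E A Q X) := by
  obtain ⟨s, p, hp⟩ := free_cover (R := E) (X := X)
  have hc := cosyz_range (A := A) q X s p hp hX
  have h1 := cosyz_ev _ Q _ 1 _ hc (fun C _ => hid C _ (by omega))
    (fun t _ => by rw [add_comm]; exact hso t)
  intro φ
  obtain ⟨v, hv⟩ := contra3 (pre A Q p) (pre A Q (LinearMap.ker p).subtype).rangeRestrict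
    (pre_inj A p hp) (LinearMap.surjective_rangeRestrict _) (by
      intro x
      rw [← pre_exact A _ _ hp (exact_ker p) x]
      exact Subtype.ext_iff) h1 φ
  obtain ⟨y, rfl⟩ := (dbl_pi s hEE).2 v
  exact ⟨p y, hv⟩

lemma dual_bij [Module.Finite A Q] (hEE : Function.Bijective (dbl E A Q E)) (m q : ℕ)
    (hmq : m ≤ q)
    (hid : ∀ (C : ModuleCat.{0} A) i, m < i → EV A C Q i) (hso : ∀ i, EV A Q Q (i+1))
    (X : Type) [AddCommGroup X] [Module E X]
    [Module.Finite E X] (hX : ∀ i, i < q → EV E X Q (i+1)) :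
    Function.Bijective (dbl E A Q X) := by
  refine ⟨?_, dual_surj hEE m q (by omega) hid hso X hX⟩
  obtain ⟨s, p, hp⟩ := free_cover (R := E) (X := X)
  have hK : ∀ i, i < q - 1 → EV E (LinearMap.ker p) Q (i+1) := fun i hi =>
    contra1 _ _ (LinearMap.ker p).subtype_injective hp (exact_ker p)
      (ev_proj i) (hX (i+1) (by omega))
  have hsK := dual_surj hEE m (q-1) (by omega) hid hso (LinearMap.ker p) hK
  let κ := (LinearMap.ker p).subtype
  have hquot : EV A ((LinearMap.ker p →ₗ[E] Q) ⧸ LinearMap.range (pre A Q κ)) Q 1 := by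
    rcases Nat.eq_zero_or_pos m with hm | hm
    · exact hid (ModuleCat.of A _) 1 (by omega)
    · have hext := contra3 _ _ (LinearMap.ker p).subtype_injective hp (exact_ker p)
        (hX 0 (by omega))
      have htop : LinearMap.range (pre A Q κ) = ⊤ := LinearMap.range_eq_top.2 hext
      have := (Submodule.Quotient.subsingleton_iff (p := LinearMap.range (pre A Q κ))).2 htop
      exact ev_sub 0
  rw [dbl_inj_iff]
  intro x hx
  obtain ⟨y, rfl⟩ := hp x
  obtain ⟨w, hw⟩ := factor (pre A Q κ).rangeRestrict (LinearMap.surjective_rangeRestrict _)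
    (dbl E A Q _ y) (by
      intro g hg
      have hg' : pre A Q κ g = 0 := congrArg Subtype.val hg
      obtain ⟨f, rfl⟩ := (pre_exact A _ _ hp (exact_ker p) g).1 hg'
      exact hx f)
  obtain ⟨w', hw'⟩ := contra3 _ _ (LinearMap.range (pre A Q κ)).subtype_injective
    (Submodule.mkQ_surjective _) (by
      intro x
      simp only [Submodule.mkQ_apply, Submodule.Quotient.mk_eq_zero]
      constructor
      · intro h; exact ⟨⟨x, h⟩, rfl⟩
      · rintro ⟨y, rfl⟩; exact y.2) hquot w
  obtain ⟨z, rfl⟩ := hsK w'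
  have : y = κ z := by
    apply (dbl_pi s hEE).1
    rw [← hw, ← hw']
    rfl
  rw [this]
  exact z.2

end Main
end P17

set_option linter.unusedSectionVars false
namespace P17
open CategoryTheory CategoryTheory.Abelian Paper

section Fwd
variable {A E Q : Type} [Ring A] [Ring E] [AddCommGroup Q] [Module A Q] [Module E Q]
  [SMulCommClass A E Q] [SMulCommClass E A Q] [IsNoetherianRing A] [IsNoetherianRing E]

lemma fin_add (N : ℕ) (hQQ : ∀ i, i < N → EV E Q Q (i+1)) (r : ℕ) (hr : r ≤ N) :
    ∀ (Y : ModuleCat.{0} A), Module.Finite A Y → (∀ i, EV A Y Q (i+1)) →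
      (∀ Z : ModuleCat.{0} A, Module.Finite A Z → EV A Y Z (r+1)) →
      (∀ j, j < r → EV E Q (Y →ₗ[A] Q) (j+1)) →
      InAdd E (ModuleCat.of E Q) (ModuleCat.of E (Y →ₗ[A] Q)) := by
  induction r with
  | zero =>
    intro Y hY _ hZ _
    obtain ⟨s, p, hp⟩ := free_cover (R := A) (X := Y)
    have h := cov3 _ _ (LinearMap.ker p).subtype_injective hp (exact_ker p)
      (hZ (ModuleCat.of A (LinearMap.ker p)) inferInstance) LinearMap.id
    exact inAdd_dual_ring (inAdd_of_lift (inAdd_pi (ModuleCat.of A A) s) p h)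
  | succ r ih =>
    intro Y hY hYQ hZ hE
    obtain ⟨s, p, hp⟩ := free_cover (R := A) (X := Y)
    have hext := contra3 _ _ (LinearMap.ker p).subtype_injective hp (exact_ker p) (hYQ 0)
    have h1 : InAdd E (ModuleCat.of E Q) (ModuleCat.of E (LinearMap.ker p →ₗ[A] Q)) := by
      refine ih (by omega) (ModuleCat.of A (LinearMap.ker p)) inferInstance ?_ ?_ ?_
      · intro i
        exact contra1 _ _ (LinearMap.ker p).subtype_injective hp (exact_ker p) (ev_proj i)
          (hYQ (i+1))
      · intro Z hZf
        exact contra1 _ _ (LinearMap.ker p).subtype_injective hp (exact_ker p) (ev_proj r)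
          (hZ Z hZf)
      · intro j hj
        exact cov1 (pre E Q p) (pre E Q (LinearMap.ker p).subtype) (pre_inj E p hp) hext
          (pre_exact E _ _ hp (exact_ker p))
          (ev_add_right (inAdd_dual_free s) (hQQ j (by omega))) (hE (j+1) (by omega))
    have h2 : EV E (LinearMap.ker p →ₗ[A] Q) (Y →ₗ[A] Q) 1 :=
      ev_add_left h1 (hE 0 (by omega))
    obtain ⟨v, hv⟩ := contra3 (pre E Q p) (pre E Q (LinearMap.ker p).subtype) (pre_inj E p hp)
      hext (pre_exact E _ _ hp (exact_ker p)) h2 LinearMap.id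
    exact inAdd_retract (X' := ModuleCat.of E ((Fin s → A) →ₗ[A] Q)) (pre E Q p) v hv
      (inAdd_dual_free s)

lemma gl_ev (n g : ℕ) (hg : ∀ X : ModuleCat.{0} A, Module.Finite A X → pdLE A X g)
    (hid : idLE A (ModuleCat.of A A) n) (t : ℕ) :
    ∀ (C Z : ModuleCat.{0} A) (i : ℕ), Module.Finite A C → Module.Finite A Z → n < i →
      g < i + t → EV A C Z i := by
  induction t with
  | zero => intro C Z i hC hZ hi hg'; exact pd_ev Z g C (hg C hC) i hg'
  | succ t ih =>
    intro C Z i hC hZ hi hg'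
    obtain ⟨s, p, hp⟩ := free_cover (R := A) (X := Z)
    exact cov1 _ _ (LinearMap.ker p).subtype_injective hp (exact_ker p)
      (ev_add_right (inAdd_pi (ModuleCat.of A A) s) (id_ev C n _ hid i hi))
      (ih C (ModuleCat.of A (LinearMap.ker p)) (i+1) hC inferInstance (by omega) (by omega))

lemma forward [Module.Finite A Q] (hEE : Function.Bijective (dbl E A Q E)) (n m l p r : ℕ)
    (hQQ : ∀ i, i < n - 2 → EV E Q Q (i+1))
    (hid : ∀ (C : ModuleCat.{0} A) i, m < i → EV A C Q i) (hso : ∀ i, EV A Q Q (i+1))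
    (hpd : ∀ (C : ModuleCat.{0} A) i, l < i → EV A Q C i)
    (hmp : m ≤ p) (hlr : l ≤ r) (hr : r ≤ n - 2) (hn : n ≤ p + r + 2)
    (hidA : idLE A (ModuleCat.of A A) n)
    (g : ℕ) (hg : ∀ X : ModuleCat.{0} A, Module.Finite A X → pdLE A X g)
    (X : ModuleCat.{0} E) (hXf : Module.Finite E X) (hX : ∀ i, i < p → EV E X Q (i+1))
    (hX' : ∀ j, j < r → EV E Q X (j+1)) : InAdd E (ModuleCat.of E Q) X := by
  have hb := dual_bij hEE m p hmp hid hso X hX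
  let e : X ≃ₗ[E] ((X →ₗ[E] Q) →ₗ[A] Q) := LinearEquiv.ofBijective _ hb
  have hc : Cosyz (ModuleCat.of A Q) (p+2) (ModuleCat.of A (X →ₗ[E] Q)) := cosyz_dual p X hX
  have hf : Module.Finite A (X →ₗ[E] Q) := dual_finite
  refine inAdd_equiv (X := ModuleCat.of E ((X →ₗ[E] Q) →ₗ[A] Q)) e.symm ?_
  refine fin_add (n-2) hQQ r hr (ModuleCat.of A (X →ₗ[E] Q)) hf ?_ ?_ ?_
  · intro i
    refine cosyz_ev _ Q _ _ _ hc (fun C _ => hid C _ (by omega)) (fun t _ => ?_)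
    have := hso (i+t)
    rwa [show i + 1 + t = i + t + 1 by omega]
  · intro Z hZ
    exact cosyz_ev _ Z _ _ _ hc
      (fun C hC => gl_ev n g hg hidA g C Z _ hC hZ (by omega) (by omega))
      (fun t _ => hpd Z _ (by omega))
  · intro j hj
    exact ev_equiv_right e.symm (hX' j hj)

end Fwd

section Conv
variable {A E Q : Type} [Ring A] [Ring E] [AddCommGroup Q] [Module A Q] [Module E Q]
  [SMulCommClass A E Q] [SMulCommClass E A Q] [IsNoetherianRing A] [IsNoetherianRing E]

lemma dual_ev (N : ℕ) (hQQ : ∀ i, i < N → EV E Q Q (i+1))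
    (hc : Function.Bijective (cmap A E Q)) (j : ℕ) (hj : j < N) :
    ∀ (Y : ModuleCat.{0} A), Module.Finite A Y → (∀ i, EV A Y Q (i+1)) →
      (∀ i, EV A Y A (i+1)) → EV E Q (Y →ₗ[A] Q) (j+1) := by
  induction j with
  | zero =>
    intro Y hY hYQ hYA
    obtain ⟨s, p, hp⟩ := free_cover (R := A) (X := Y)
    have hext := contra3 _ _ (LinearMap.ker p).subtype_injective hp (exact_ker p) (hYQ 0)
    refine cov2' (pre E Q p) (pre E Q (LinearMap.ker p).subtype) (pre_inj E p hp) hext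
      (pre_exact E _ _ hp (exact_ker p)) ?_
      (ev_add_right (inAdd_dual_free s) (hQQ 0 (by omega)))
    intro φ
    let c := LinearEquiv.ofBijective _ hc
    let h1 : LinearMap.ker p →ₗ[A] (Q →ₗ[E] Q) :=
      { toFun := fun y =>
          { toFun := fun q => φ q y
            map_add' := fun a b => by rw [map_add]; rfl
            map_smul' := fun a b => by rw [map_smul]; rfl }
        map_add' := fun a b => by ext q; exact map_add (φ q) a b
        map_smul' := fun a b => by ext q; exact map_smul (φ q) a b }
    obtain ⟨h, hh⟩ := contra3 _ _ (LinearMap.ker p).subtype_injective hp (exact_ker p) (hYA 0)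
      (c.symm.toLinearMap ∘ₗ h1)
    let ψ : Q →ₗ[E] ((Fin s → A) →ₗ[A] Q) :=
      { toFun := fun q =>
          { toFun := fun v => h v • q
            map_add' := fun a b => by rw [map_add, add_smul]
            map_smul' := fun a b => by rw [map_smul, smul_eq_mul, mul_smul]; rfl }
        map_add' := fun a b => by ext v; exact smul_add _ _ _
        map_smul' := fun a b => by ext v; exact smul_comm _ _ _ }
    refine ⟨ψ, ?_⟩
    refine LinearMap.ext fun q => LinearMap.ext fun y => ?_
    change h ((LinearMap.ker p).subtype y) • q = φ q y
    have e1 : h ((LinearMap.ker p).subtype y) = c.symm (h1 y) := congrArg (fun w => w y) hh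
    rw [e1]
    have e2 : c (c.symm (h1 y)) = h1 y := c.apply_symm_apply _
    exact congrArg (fun w => w q) e2
  | succ j ih =>
    intro Y hY hYQ hYA
    obtain ⟨s, p, hp⟩ := free_cover (R := A) (X := Y)
    have hext := contra3 _ _ (LinearMap.ker p).subtype_injective hp (exact_ker p) (hYQ 0)
    refine cov2 (pre E Q p) (pre E Q (LinearMap.ker p).subtype) (pre_inj E p hp) hext
      (pre_exact E _ _ hp (exact_ker p))
      (ih (by omega) (ModuleCat.of A (LinearMap.ker p)) inferInstance (fun i => ?_) (fun i => ?_))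
      (ev_add_right (inAdd_dual_free s) (hQQ (j+1) (by omega)))
    · exact contra1 _ _ (LinearMap.ker p).subtype_injective hp (exact_ker p) (ev_proj i)
        (hYQ (i+1))
    · exact contra1 _ _ (LinearMap.ker p).subtype_injective hp (exact_ker p) (ev_proj i)
        (hYA (i+1))

/-- Properties enjoyed by `k`-th syzygies. -/
structure Syz (A E Q : Type) [Ring A] [Ring E] [AddCommGroup Q] [Module A Q] [Module E Q]
    [SMulCommClass A E Q] [SMulCommClass E A Q] (n m k : ℕ) (Y : ModuleCat.{0} A) : Prop where
  fin : Module.Finite A Y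
  evA : ∀ i, n < i + 1 + k → EV A Y A (i+1)
  evQ : ∀ i, m < i + 1 + k → EV A Y Q (i+1)
  inj : 1 ≤ k → Function.Injective (dbl A E Q Y)
  bij : m + 2 ≤ k → Function.Bijective (dbl A E Q Y)
  evD : ∀ i, i < n - 2 → m + 2 + i < k → EV E (Y →ₗ[A] Q) Q (i+1)

lemma syz_succ (n m : ℕ) (hQQ : ∀ i, i < n - 2 → EV E Q Q (i+1))
    (hA : Function.Bijective (dbl A E Q A)) (k : ℕ) (Y : ModuleCat.{0} A)
    (h : Syz A E Q n m k Y) (s : ℕ) (p : (Fin s → A) →ₗ[A] Y) (hp : Function.Surjective p) :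
    Syz A E Q n m (k+1) (ModuleCat.of A (LinearMap.ker p)) where
  fin := inferInstanceAs (Module.Finite A (LinearMap.ker p))
  evA i hi := contra1 _ _ (LinearMap.ker p).subtype_injective hp (exact_ker p) (ev_proj i)
        (h.evA (i+1) (by omega))
  evQ i hi := contra1 _ _ (LinearMap.ker p).subtype_injective hp (exact_ker p) (ev_proj i)
        (h.evQ (i+1) (by omega))
  inj _ := dbl_inj_sub _ (LinearMap.ker p).subtype_injective (dbl_pi s hA).1
  bij hk := dbl_ker _ _ (LinearMap.ker p).subtype_injective (exact_ker p)
    (contra3 _ _ (LinearMap.ker p).subtype_injective hp (exact_ker p) (h.evQ 0 (by omega)))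
    (dbl_pi s hA) (h.inj (by omega))
  evD i hi hk := by
    have hext := contra3 _ _ (LinearMap.ker p).subtype_injective hp (exact_ker p)
      (h.evQ 0 (by omega))
    cases i with
    | zero => exact dual_ext_one _ _ hp (exact_ker p) hext (h.bij (by omega)).2
                  (ev_add_left (inAdd_dual_free s) (hQQ 0 hi))
    | succ i => exact dual_ext_succ _ _ hp (exact_ker p) hext _ (h.evD i (by omega) (by omega))
                  (ev_add_left (inAdd_dual_free s) (hQQ (i+1) hi))

lemma converse [Module.Finite E Q] (n m p r : ℕ) (hn : 2 ≤ n)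
    (hQQ : ∀ i, i < n - 2 → EV E Q Q (i+1))
    (hA : Function.Bijective (dbl A E Q A))
    (hid : ∀ (C : ModuleCat.{0} A) i, m < i → EV A C Q i)
    (hidA : idLE A (ModuleCat.of A A) n) (hp : p ≤ n - 2) (hr : r ≤ n - 2)
    (H : ∀ X : ModuleCat.{0} E, Module.Finite E X → (∀ i, i < p → EV E X Q (i+1)) →
      (∀ j, j < r → EV E Q X (j+1)) → InAdd E (ModuleCat.of E Q) X) :
    ∀ X : ModuleCat.{0} A, Module.Finite A X → pdLE A X (m+n) := by
  have key : ∀ (t k : ℕ) (Y : ModuleCat.{0} A), k + t = m + n → Syz A E Q n m k Y →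
      pdLE A Y t := by
    intro t
    induction t with
    | zero =>
      intro k Y hk hY
      have := hY.fin
      have hb := hY.bij (by omega)
      have hc := cmap_bij hA
      refine pd_zero Y (inAdd_proj ?_)
      have h1 : InAdd E (ModuleCat.of E Q) (ModuleCat.of E (Y →ₗ[A] Q)) :=
        H (ModuleCat.of E (Y →ₗ[A] Q)) dual_finite
          (fun i hi => hY.evD i (by omega) (by omega))
          (fun j hj => dual_ev (n-2) hQQ hc j (by omega) Y hY.fin
            (fun i => hY.evQ i (by omega)) (fun i => hY.evA i (by omega)))
      have h2 : InAdd A (ModuleCat.of A (Q →ₗ[E] Q))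
          (ModuleCat.of A ((Y →ₗ[A] Q) →ₗ[E] Q)) := inAdd_dual h1
      exact inAdd_equiv (X := ModuleCat.of A ((Y →ₗ[A] Q) →ₗ[E] Q))
        (LinearEquiv.ofBijective _ hb).symm
        (inAdd_equiv' (Q := ModuleCat.of A (Q →ₗ[E] Q)) (Q' := ModuleCat.of A A)
          (LinearEquiv.ofBijective _ hc).symm h2)
    | succ t ih =>
      intro k Y hk hY
      have := hY.fin
      obtain ⟨s, p, hp⟩ := free_cover (R := A) (X := Y)
      exact pd_succ (P := ModuleCat.of A (Fin s → A))
        (inferInstanceAs (Module.Projective A (Fin s → A))) p hp t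
        (ih (k+1) _ (by omega) (syz_succ n m hQQ hA k Y hY s p hp))
  intro X hX
  refine key (m+n) 0 X (by omega) ⟨hX, ?_, ?_, ?_, ?_, ?_⟩
  · intro i hi; exact id_ev X n _ hidA _ (by omega)
  · intro i hi; exact hid X _ (by omega)
  · intro h; omega
  · intro h; omega
  · intro i _ h; omega

lemma equiv_main [Module.Finite A Q] [Module.Finite E Q]
    (hEE : Function.Bijective (dbl E A Q E)) (hA : Function.Bijective (dbl A E Q A))
    (n m l p r : ℕ) (hQQ : ∀ i, i < n - 2 → EV E Q Q (i+1))
    (hid : ∀ (C : ModuleCat.{0} A) i, m < i → EV A C Q i) (hso : ∀ i, EV A Q Q (i+1))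
    (hpd : ∀ (C : ModuleCat.{0} A) i, l < i → EV A Q C i)
    (hmp : m ≤ p) (hlr : l ≤ r) (hn : n = p + r + 2)
    (hidA : idLE A (ModuleCat.of A A) n) :
    (∃ g, ∀ X : ModuleCat.{0} A, Module.Finite A X → pdLE A X g) ↔
     (∀ X : ModuleCat.{0} E, Module.Finite E X →
       (InAdd E (ModuleCat.of E Q) X ↔
        ((∀ i, 1 ≤ i → i ≤ p → ExtVanish E X (ModuleCat.of E Q) i) ∧
         (∀ j, 1 ≤ j → j ≤ r → ExtVanish E (ModuleCat.of E Q) X j)))) := by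
  simp only [bridge_range]
  constructor
  · rintro ⟨g, hg⟩ X hX
    constructor
    · intro h
      exact ⟨fun i hi => ev_add_left h (hQQ i (by omega)),
        fun i hi => ev_add_right h (hQQ i (by omega))⟩
    · rintro ⟨h1, h2⟩
      exact forward hEE n m l p r hQQ hid hso hpd hmp hlr (by omega) (by omega) hidA g hg X hX
        h1 h2
  · intro H
    exact ⟨m+n, converse n m p r (by omega) hQQ hA hid hidA (by omega) (by omega)
      (fun X hX h1 h2 => (H X hX).2 ⟨h1, h2⟩)⟩

end Conv
end P17

set_option linter.unusedSectionVars false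
namespace P17
open CategoryTheory CategoryTheory.Abelian Paper

lemma finite_stuff (k : Type) [Field k] (A : Type) [Ring A] [Algebra k A]
    [FiniteDimensional k A] (Q : Type) [AddCommGroup Q] [Module A Q] [Module.Finite A Q] :
    IsNoetherianRing A ∧ IsNoetherianRing (Module.End A Q) ∧
      Module.Finite (Module.End A Q) Q := by
  let _ : Module k Q := Module.compHom Q (algebraMap k A)
  have : IsScalarTower k A Q := IsScalarTower.of_algebraMap_smul (fun _ _ => rfl)
  have : SMulCommClass A k Q := IsScalarTower.to_smulCommClass'
  have : Module.Finite k Q := Module.Finite.trans A Q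
  let φ : (Module.End A Q) →ₗ[k] (Q →ₗ[k] Q) :=
    { toFun := fun f => f.restrictScalars k
      map_add' := fun _ _ => rfl
      map_smul' := fun _ _ => rfl }
  have : Module.Finite k (Module.End A Q) :=
    Module.Finite.of_injective φ (fun f g h => by
      ext q; exact congrArg (fun w => w q) h)
  have : IsScalarTower k (Module.End A Q) Q := ⟨fun _ _ _ => rfl⟩
  exact ⟨IsNoetherianRing.of_finite k A, IsNoetherianRing.of_finite k _,
    Module.Finite.of_restrictScalars_finite k _ _⟩

section Conc
variable {A : Type} [Ring A] (Q : ModuleCat.{0} A)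

lemma conc_QA : Function.Bijective (dbl A (Module.End A Q) Q Q) := by
  constructor
  · rw [dbl_inj_iff]
    intro x hx
    exact hx LinearMap.id
  · intro φ
    refine ⟨φ LinearMap.id, ?_⟩
    refine LinearMap.ext fun f => ?_
    have := φ.map_smul (show Module.End A Q from f) LinearMap.id
    exact this.symm

lemma conc_EE : Function.Bijective (dbl (Module.End A Q) A Q (Module.End A Q)) := by
  constructor
  · rw [dbl_inj_iff]
    intro e he
    ext q
    exact he (LinearMap.toSpanSingleton (Module.End A Q) Q q)
  · intro φ
    let T : Q →ₗ[A] (Module.End A Q →ₗ[Module.End A Q] Q) :=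
      { toFun := fun q => LinearMap.toSpanSingleton (Module.End A Q) Q q
        map_add' := fun a b => by ext; simp
        map_smul' := fun a b => by ext; simp }
    refine ⟨φ ∘ₗ T, ?_⟩
    refine LinearMap.ext fun f => ?_
    have hf : f = T (f 1) := by
      refine LinearMap.ext fun e => ?_
      change f e = e • f 1
      rw [← map_smul, smul_eq_mul, mul_one]
    change f (φ ∘ₗ T) = φ f
    have h2 : f (φ ∘ₗ T) = (φ ∘ₗ T : Module.End A Q) • f 1 := by
      rw [← map_smul]
      congr 1
    rw [h2]
    conv_rhs => rw [hf]
    rfl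

end Conc
end P17

noncomputable section Statement17
open Paper

/-- Corollary 5.6: for a relative `n`-Auslander–Gorenstein pair
`(A, Q)` with `n ≥ m + l + 2`, the following are equivalent: (i) `A` has finite
global dimension; (ii) `add Q_Λ = ⊥m Q ∩ Q⊥(n−m−2)`; (iii)
`add Q_Λ = ⊥(n−l−2) Q ∩ Q⊥l` (`Λ = End_A(Q)^op`; right `Λ`-modules are left
`End_A(Q)`-modules). -/
theorem stmt17 (k : Type) [Field k] (A : Type) [Ring A] [Algebra k A]
    [FiniteDimensional k A]
    (Q : ModuleCat.{0} A) [Module.Finite A Q] (n m l : ℕ)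
    (hpair : IsRelAGPair A Q n) (hpd : pdEq A Q l) (hid : idEq A Q m)
    (hn : m + l + 2 ≤ n) :
    ((∃ g, ∀ X : ModuleCat.{0} A, Module.Finite A X → pdLE A X g) ↔
     (∀ X : ModuleCat.{0} (Module.End A Q), Module.Finite (Module.End A Q) X →
       (InAdd (Module.End A Q) (ModuleCat.of (Module.End A Q) Q) X ↔
        ((∀ i, 1 ≤ i → i ≤ m →
           ExtVanish (Module.End A Q) X (ModuleCat.of (Module.End A Q) Q) i) ∧
         (∀ j, 1 ≤ j → j ≤ n - m - 2 →
           ExtVanish (Module.End A Q) (ModuleCat.of (Module.End A Q) Q) X j))))) ∧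
    ((∃ g, ∀ X : ModuleCat.{0} A, Module.Finite A X → pdLE A X g) ↔
     (∀ X : ModuleCat.{0} (Module.End A Q), Module.Finite (Module.End A Q) X →
       (InAdd (Module.End A Q) (ModuleCat.of (Module.End A Q) Q) X ↔
        ((∀ i, 1 ≤ i → i ≤ n - l - 2 →
           ExtVanish (Module.End A Q) X (ModuleCat.of (Module.End A Q) Q) i) ∧
         (∀ j, 1 ≤ j → j ≤ l →
           ExtVanish (Module.End A Q) (ModuleCat.of (Module.End A Q) Q) X j))))) := by
  obtain ⟨hidA, -, hso, hdd⟩ := hpair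
  obtain ⟨iA, iE, iF⟩ := P17.finite_stuff k A Q
  have hDD := P17.DD_of_domdim Q n _ hdd
  obtain ⟨N, rfl⟩ : ∃ N, n = N + 2 := ⟨n-2, by omega⟩
  have hA : Function.Bijective (P17.dbl A (Module.End A Q) Q A) :=
    P17.DD_refl (P17.conc_QA Q) N (ModuleCat.of A A) hDD
  have hP : Module.Projective (Module.End A Q) (Q →ₗ[A] Q) :=
    inferInstanceAs (Module.Projective (Module.End A Q) (Module.End A Q))
  have hQQ : ∀ i, i < N + 2 - 2 → P17.EV (Module.End A Q) Q Q (i+1) := fun i hi =>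
    P17.ev_equiv_left (LinearMap.ringLmapEquivSelf A (Module.End A Q) Q).symm
      (P17.DD_ext (P17.conc_QA Q) hP i N (ModuleCat.of A A) (by omega) hDD)
  have hid' : ∀ (C : ModuleCat.{0} A) i, m < i → P17.EV A C Q i :=
    fun C i hi => P17.id_ev C m Q hid.1 i hi
  have hpd' : ∀ (C : ModuleCat.{0} A) i, l < i → P17.EV A Q C i :=
    fun C i hi => P17.pd_ev C l Q hpd.1 i hi
  have hso' : ∀ i, P17.EV A Q Q (i+1) := fun i => (P17.bridge Q Q i).1 (hso _ (by omega))
  exact ⟨P17.equiv_main (P17.conc_EE Q) hA (N+2) m l m (N+2-m-2) hQQ hid' hso' hpd' le_rfl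
      (by omega) (by omega) hidA,
    P17.equiv_main (P17.conc_EE Q) hA (N+2) m l (N+2-l-2) l hQQ hid' hso' hpd' (by omega)
      le_rfl (by omega) hidA⟩


end Statement17
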